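/- arXiv:math/9807022 — 5 statements merged into one kernel-verified Lean document; each statement's English description precedes it below -/
import Mathlib

section
/- If G is a tree other than a star, then l(G) equals the number of leaves of the derived tree G'. -/
open SimpleGraph

namespace Leafage

variable {V : Type*}

/-- A closed walk has a chord: an edge of the graph joining two vertices of the walk
that is not an edge of the walk. -/
def HasChord (G : SimpleGraph V) {v : V} (c : G.Walk v v) : Prop :=
  ∃ x y, x ∈ c.support ∧ y ∈ c.support ∧ G.Adj x y ∧ s(x, y) ∉ c.edges

/-- A graph is chordal if every cycle of length exceeding 3 has a chord. -/
def IsChordal (G : SimpleGraph V) : Prop :=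
  ∀ (v : V) (c : G.Walk v v), c.IsCycle → 3 < c.length → HasChord G c

/-- A leaf of a tree is a vertex of degree 1. -/
def IsLeaf (T : SimpleGraph V) (v : V) : Prop := (T.neighborSet v).ncard = 1

/-- The number of leaves of a tree. -/
noncomputable def numLeaves (T : SimpleGraph V) : ℕ := {v | IsLeaf T v}.ncard

/-- A subtree of a tree `T`, described by its vertex set: a set of vertices inducing a
(nonempty) connected subgraph. -/
def IsSubtree (T : SimpleGraph V) (S : Set V) : Prop := (T.induce S).Connected

/-- A subtree representation of `G` in a host tree `T`: each vertex `v` is assigned a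
subtree `f v` of `T`, and distinct vertices are adjacent iff their subtrees meet. -/
def IsSubtreeRep {α β : Type*} (G : SimpleGraph α) (T : SimpleGraph β) (f : α → Set β) : Prop :=
  (∀ v, IsSubtree T (f v)) ∧ ∀ u v, u ≠ v → (G.Adj u v ↔ (f u ∩ f v).Nonempty)

/-- A proper subtree representation: no subtree properly contains another. -/
def IsProperSubtreeRep {α β : Type*} (G : SimpleGraph α) (T : SimpleGraph β)
    (f : α → Set β) : Prop :=
  IsSubtreeRep G T f ∧ ∀ u v, u ≠ v → ¬ f u ⊂ f v

/-- The leafage of a graph: the minimum number of leaves of the host tree over all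
subtree representations. -/
noncomputable def leafage {α : Type*} (G : SimpleGraph α) : ℕ :=
  sInf {L | ∃ (m : ℕ) (T : SimpleGraph (Fin m)) (f : α → Set (Fin m)),
    T.IsTree ∧ IsSubtreeRep G T f ∧ numLeaves T = L}

/-- The proper leafage of a graph: the minimum number of leaves of the host tree over all
proper subtree representations. -/
noncomputable def properLeafage {α : Type*} (G : SimpleGraph α) : ℕ :=
  sInf {L | ∃ (m : ℕ) (T : SimpleGraph (Fin m)) (f : α → Set (Fin m)),
    T.IsTree ∧ IsProperSubtreeRep G T f ∧ numLeaves T = L}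

/-- `C` is between `A` and `B` (as subtrees of the tree `T`): `A` and `B` are disjoint and
the unique path of `T` connecting them meets `C` (equivalently, every walk from `A` to `B`
meets `C`). -/
def Between (T : SimpleGraph V) (A B C : Set V) : Prop :=
  Disjoint A B ∧ ∀ u v, u ∈ A → v ∈ B → ∀ p : T.Walk u v, ∃ x ∈ p.support, x ∈ C

/-- An asteroidal collection of subtrees: pairwise disjoint, and none between two others. -/
def AsteroidalCollection {ι : Type*} (T : SimpleGraph V) (Ts : ι → Set V) : Prop :=
  (∀ i j, i ≠ j → Disjoint (Ts i) (Ts j)) ∧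
    ∀ i j k, i ≠ j → j ≠ k → i ≠ k → ¬ Between T (Ts i) (Ts j) (Ts k)

/-- `x, y, z` form an asteroidal triple when each pair is joined by a path avoiding the
closed neighborhood of the third; by symmetry we record the path from `x` to `y`
avoiding `N[z]` and quantify over all orderings in `AsteroidalSet`. -/
def AsteroidalTriple (G : SimpleGraph V) (x y z : V) : Prop :=
  ∃ p : G.Walk x y, ∀ w ∈ p.support, w ≠ z ∧ ¬ G.Adj z w

/-- An asteroidal set: every triple of its vertices is an asteroidal triple. -/
def AsteroidalSet (G : SimpleGraph V) (A : Set V) : Prop :=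
  ∀ x ∈ A, ∀ y ∈ A, ∀ z ∈ A, x ≠ y → y ≠ z → x ≠ z → AsteroidalTriple G x y z

/-- `a(G)`: the maximum size of an asteroidal set in `G`. -/
noncomputable def astNum (G : SimpleGraph V) : ℕ :=
  sSup {n | ∃ A : Set V, AsteroidalSet G A ∧ A.ncard = n}

/-- A simplicial vertex: its neighborhood induces a clique. -/
def IsSimplicial (G : SimpleGraph V) (v : V) : Prop := G.IsClique (G.neighborSet v)

/-- The derived graph `G'`: the induced subgraph on the non-simplicial vertices. -/
def derivedGraph (G : SimpleGraph V) : SimpleGraph {v | ¬ IsSimplicial G v} :=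
  G.induce {v | ¬ IsSimplicial G v}

/-- A cutset: a set of vertices whose deletion leaves a disconnected subgraph. -/
def IsCutset {β : Type*} (H : SimpleGraph β) (S : Set β) : Prop :=
  (Sᶜ : Set β).Nonempty ∧ ¬ (H.induce Sᶜ).Preconnected

/-- A cut-vertex: some two other vertices are connected in `H` but not in `H - v`. -/
def IsCutVertex {β : Type*} (H : SimpleGraph β) (v : β) : Prop :=
  ∃ x y : ({v}ᶜ : Set β), H.Reachable ↑x ↑y ∧ ¬ (H.induce ({v}ᶜ : Set β)).Reachable x y

/-- A `k`-tree: there is a construction ordering of the vertices in which the first `k`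
vertices form a `k`-clique and each later vertex's neighborhood among earlier vertices is
a `k`-clique. -/
def IsKTree (k : ℕ) (G : SimpleGraph V) : Prop :=
  ∃ (n : ℕ) (e : Fin n ≃ V), k ≤ n ∧
    (∀ i j : Fin n, (i : ℕ) < k → (j : ℕ) < k → i ≠ j → G.Adj (e i) (e j)) ∧
    ∀ i : Fin n, k ≤ (i : ℕ) →
      G.IsClique {v | G.Adj (e i) v ∧ ∃ j, j < i ∧ e j = v} ∧
      {v | G.Adj (e i) v ∧ ∃ j, j < i ∧ e j = v}.ncard = k

/-- The collection of modified simplicial neighborhoods `N(v) - S(G)` for `v` simplicial;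
the poset `P(G)` is this collection ordered by inclusion. -/
def modNbhds (G : SimpleGraph V) : Set (Set V) :=
  {R | ∃ v, IsSimplicial G v ∧ R = G.neighborSet v \ {w | IsSimplicial G w}}

/-- The width of a family of sets under inclusion: the maximum size of an antichain. -/
noncomputable def familyWidth {β : Type*} (F : Set (Set β)) : ℕ :=
  sSup {n | ∃ A, A ⊆ F ∧ (∀ x ∈ A, ∀ y ∈ A, x ≠ y → ¬ x ⊆ y) ∧ A.ncard = n}

/-- The restricted simplicial neighborhood poset `P'(G)`: the modified simplicial
neighborhoods that do not contain a cutset of the derived graph `G'`. -/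
def restrictedModNbhds (G : SimpleGraph V) : Set (Set V) :=
  {R ∈ modNbhds G | ¬ ∃ C, C ⊆ R ∧ IsCutset (derivedGraph G) (Subtype.val ⁻¹' C)}

/-- The closed neighborhood `N[a]`. -/
def closedNbhd (G : SimpleGraph V) (a : V) : Set V := insert a (G.neighborSet a)

/-- Two vertices are equivalent if they have the same closed neighborhood. -/
def EquivVerts (G : SimpleGraph V) (u v : V) : Prop := closedNbhd G u = closedNbhd G v

/-- A graph is reduced if no two distinct vertices are equivalent. -/
def IsReduced (G : SimpleGraph V) : Prop := ∀ u v, EquivVerts G u v → u = v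

/-- The boundary `∂H` of a component `H` of `G - N[a]`: the vertices of `N[a]` having a
neighbor in `H`. -/
def compBoundary (G : SimpleGraph V) (a : V)
    (C : (G.induce (closedNbhd G a)ᶜ).ConnectedComponent) : Set V :=
  {x | x ∈ closedNbhd G a ∧ ∃ h : ((closedNbhd G a)ᶜ : Set V),
    (G.induce (closedNbhd G a)ᶜ).connectedComponentMk h = C ∧ G.Adj x ↑h}

/-- A modified extreme point (MEP): a simplicial vertex `a` such that all components of
`G - N[a]` have the same boundary. -/
def IsMEP (G : SimpleGraph V) (a : V) : Prop :=
  IsSimplicial G a ∧ ∀ C₁ C₂ : (G.induce (closedNbhd G a)ᶜ).ConnectedComponent,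
    compBoundary G a C₁ = compBoundary G a C₂

/-- An extreme point (EP): a simplicial vertex `a` such that every pair of distinct
vertices of `N(a)` not equivalent to `a` have a common neighbor outside `N[a]`. -/
def IsEP (G : SimpleGraph V) (a : V) : Prop :=
  IsSimplicial G a ∧ ∀ x ∈ G.neighborSet a, ∀ y ∈ G.neighborSet a, x ≠ y →
    ¬ EquivVerts G x a → ¬ EquivVerts G y a →
      ∃ z, z ∉ closedNbhd G a ∧ G.Adj x z ∧ G.Adj y z

/-- A block of `G`, as a vertex set: a maximal set inducing a connected subgraph
with no cut-vertex. -/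
def IsBlock (G : SimpleGraph V) (B : Set V) : Prop :=
  (G.induce B).Connected ∧ (∀ v : B, ¬ IsCutVertex (G.induce B) v) ∧
    ∀ B', B ⊆ B' → (G.induce B').Connected →
      (∀ v : B', ¬ IsCutVertex (G.induce B') v) → B' = B

/-- A block graph: every block is a clique. -/
def IsBlockGraph (G : SimpleGraph V) : Prop := ∀ B, IsBlock G B → G.IsClique B

/-- A leaf block: a block containing exactly one cut-vertex of `G`. -/
def IsLeafBlock (G : SimpleGraph V) (B : Set V) : Prop :=
  IsBlock G B ∧ {v | v ∈ B ∧ IsCutVertex G v}.ncard = 1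

/-- Claw-free: no induced subgraph isomorphic to `K_{1,3}`. -/
def ClawFree (G : SimpleGraph V) : Prop :=
  ¬ ∃ a b c d : V, b ≠ c ∧ b ≠ d ∧ c ≠ d ∧ G.Adj a b ∧ G.Adj a c ∧ G.Adj a d ∧
    ¬ G.Adj b c ∧ ¬ G.Adj b d ∧ ¬ G.Adj c d

/-- The set of the first `i+1` vertices in the ordering `e`. -/
def prefixSet {n : ℕ} (e : Fin n ≃ V) (i : Fin n) : Set V := {v | ∃ j, j ≤ i ∧ e j = v}

/-- A perfect elimination ordering, read in reverse (build order) as `e 0, e 1, …`: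
the neighborhood of each vertex among earlier vertices is a clique. -/
def IsPEO (G : SimpleGraph V) {n : ℕ} (e : Fin n ≃ V) : Prop :=
  ∀ i : Fin n, G.IsClique {v | G.Adj (e i) v ∧ ∃ j, j < i ∧ e j = v}

/-- `Q` is a maximal clique within the vertex set `W`. -/
def MaxCliqueIn (G : SimpleGraph V) (W Q : Set V) : Prop :=
  Q ⊆ W ∧ G.IsClique Q ∧ ∀ Q', Q' ⊆ W → G.IsClique Q' → Q ⊆ Q' → Q' = Q

/-- The creation time of a maximal clique `C` of `G` with respect to the build order `e`:
the first step at which the part of `C` built so far is a maximal clique of the graph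
built so far. -/
noncomputable def creationTime (G : SimpleGraph V) {n : ℕ} (e : Fin n ≃ V)
    (C : Set V) : ℕ :=
  sInf {t | ∃ i : Fin n, (i : ℕ) = t ∧ MaxCliqueIn G (prefixSet e i) (C ∩ prefixSet e i)}

/-- `Q` is the creation ordering of the maximal cliques of `G` with respect to the perfect
elimination ordering `e`: an enumeration of all maximal cliques of `G` listed in order of
creation. -/
def IsCreationOrdering (G : SimpleGraph V) {n : ℕ} (e : Fin n ≃ V) {m : ℕ}
    (Q : Fin m → Set V) : Prop :=
  Function.Injective Q ∧ (∀ i, MaxCliqueIn G Set.univ (Q i)) ∧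
    (∀ C, MaxCliqueIn G Set.univ C → ∃ i, Q i = C) ∧
    StrictMono fun i => creationTime G e (Q i)

/-- The width of the subposet of a poset on the set `S`: the maximum size of an
antichain contained in `S`. -/
noncomputable def widthIn {P : Type*} [PartialOrder P] (S : Set P) : ℕ :=
  sSup {n | ∃ A : Set P, A ⊆ S ∧ IsAntichain (· ≤ ·) A ∧ A.ncard = n}

end Leafage

open SimpleGraph Leafage

namespace SimpleGraph

variable {V : Type*} {G : SimpleGraph V}

lemma IsTree.mem_support_of_dist_eq_add_one (hG : G.IsTree) {x y z : V} (h : G.Adj z x)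
    (hd : G.dist z y = G.dist x y + 1) (p : G.Walk z y) : x ∈ p.support := by
  classical
  obtain ⟨q, hq⟩ := hG.connected.exists_walk_length_eq_dist x y
  have hpath : (Walk.cons h q).IsPath := Walk.isPath_of_length_eq_dist _ (by simp [hq, hd])
  have := (hG.isAcyclic.subsingleton_path z y).elim ⟨_, hpath⟩ ⟨_, p.bypass_isPath⟩
  have h1 : Walk.cons h q = p.bypass := congrArg Subtype.val this
  apply p.support_bypass_subset_support
  rw [← h1]
  simp

lemma IsTree.eq_of_adj_of_dist_lt (hG : G.IsTree) {x y a b : V} (ha : G.Adj x a)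
    (hb : G.Adj x b) (hda : G.dist a y < G.dist x y) (hdb : G.dist b y < G.dist x y) :
    a = b := by
  have key : ∀ c, G.Adj x c → G.dist c y < G.dist x y → G.dist x y = G.dist c y + 1 := by
    intro c hc hlt
    have := hG.connected.dist_triangle (u := x) (v := c) (w := y)
    rw [dist_eq_one_iff_adj.2 hc] at this
    omega
  obtain ⟨q, hq⟩ := hG.connected.exists_walk_length_eq_dist b y
  have := hG.mem_support_of_dist_eq_add_one ha (key a ha hda) (Walk.cons hb q)
  rw [Walk.support_cons, List.mem_cons] at this
  rcases this with h | h
  · exact absurd h.symm ha.ne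
  classical
  by_contra hne
  have h1 := key a ha hda
  have h2 := key b hb hdb
  have h3 := dist_le (q.dropUntil a h)
  have h4 := congrArg Walk.length (q.take_spec h)
  rw [Walk.length_append] at h4
  have h5 : (q.takeUntil a h).length ≠ 0 := fun h0 ↦ hne (Walk.eq_of_length_eq_zero h0).symm
  omega

lemma IsTree.dist_lt_or_gt_of_adj (hG : G.IsTree) {x z : V} (h : G.Adj x z) (y : V) :
    G.dist x y < G.dist z y ∨ G.dist z y < G.dist x y := by
  have := hG.dist_ne_of_adj y h
  rw [G.dist_comm (u := x), G.dist_comm (u := z)]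
  omega

lemma IsAcyclic.not_adj_of_adj_of_adj (hG : G.IsAcyclic) {a b c : V} (hab : G.Adj a b)
    (hac : G.Adj a c) : ¬ G.Adj b c := by
  classical
  intro hbc
  exact hG.cliqueFree le_rfl {a, b, c} (is3Clique_iff.2 ⟨a, b, c, hab, hac, hbc, rfl⟩)

end SimpleGraph

namespace Leafage

section LowerBound

variable {β : Type*} {T : SimpleGraph β}

/-- Some leaf of the tree is separated from `y` by `S`. -/
lemma exists_isLeaf_of_barrier [Finite β] (hT : T.IsTree) {S : Set β} {y : β} (hS : S.Nonempty)
    (hy : y ∉ S) :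
    ∃ x, IsLeaf T x ∧ ∀ p : T.Walk x y, ∃ z ∈ p.support, z ∈ S := by
  let D : Set β := {x | ∀ p : T.Walk x y, ∃ z ∈ p.support, z ∈ S}
  have hD : D.Nonempty := hS.imp fun s hs p ↦ ⟨s, p.start_mem_support, hs⟩
  obtain ⟨x, hxD, hmax⟩ := D.toFinite.exists_maximalFor (fun x ↦ T.dist x y) D hD
  refine ⟨x, ?_, hxD⟩
  have hxy : x ≠ y := by
    rintro rfl
    obtain ⟨z, hz, hzS⟩ := hxD .nil
    simp only [Walk.support_nil, List.mem_singleton] at hz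
    exact hy (hz ▸ hzS)
  have hclose : ∀ z, T.Adj x z → T.dist z y < T.dist x y := by
    intro z hz
    refine (hT.dist_lt_or_gt_of_adj hz y).resolve_left fun hlt ↦ ?_
    have hzD : z ∈ D := by
      intro p
      classical
      have htri := hT.connected.dist_triangle (u := z) (v := x) (w := y)
      rw [dist_eq_one_iff_adj.2 hz.symm] at htri
      have hx := hT.mem_support_of_dist_eq_add_one hz.symm (by omega) p
      obtain ⟨w, hw, hwS⟩ := hxD (p.dropUntil x hx)
      exact ⟨w, p.support_dropUntil_subset_support hx hw, hwS⟩
    have := hmax hzD hlt.le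
    simp only at this
    omega
  obtain ⟨p⟩ := hT.connected.preconnected x y
  cases p with
  | nil => exact absurd rfl hxy
  | @cons _ a _ h _ =>
    rw [IsLeaf, Set.ncard_eq_one]
    refine ⟨a, Set.eq_singleton_iff_unique_mem.2 ⟨h, fun b hb ↦ ?_⟩⟩
    exact hT.eq_of_adj_of_dist_lt hb h (hclose _ hb) (hclose _ h)

/-- Disjoint sets cannot both block the other one from the same point. -/
lemma false_of_mutual_barrier {S S' : Set β} (hdisj : Disjoint S S') {x : β}
    (h : ∀ a ∈ S, ∀ p : T.Walk x a, ∃ z ∈ p.support, z ∈ S')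
    (h' : ∀ a ∈ S', ∀ p : T.Walk x a, ∃ z ∈ p.support, z ∈ S) (n : ℕ) :
    ∀ a ∈ S ∪ S', ∀ p : T.Walk x a, p.length = n → False := by
  classical
  induction n using Nat.strong_induction_on with
  | _ n ih =>
    have key : ∀ a z, ∀ p : T.Walk x a, p.length = n → z ∈ p.support → a ≠ z →
        z ∈ S ∪ S' → False := fun a z p hp hz hne hzS ↦
      ih _ (hp ▸ p.length_takeUntil_lt_length hz hne.symm) z hzS (p.takeUntil z hz) rfl
    rintro a (ha | ha) p hp
    · obtain ⟨z, hz, hzS⟩ := h a ha p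
      exact key a z p hp hz (hdisj.ne_of_mem ha hzS) (.inr hzS)
    · obtain ⟨z, hz, hzS⟩ := h' a ha p
      exact key a z p hp hz (hdisj.ne_of_mem hzS ha).symm (.inl hzS)

/-- A walk of `G` avoiding the vertices whose subtrees meet `S` lifts to a walk of the host tree
avoiding `S`. -/
lemma exists_walk_disjoint {α : Type*} {G : SimpleGraph α} {f : α → Set β}
    (hf : IsSubtreeRep G T f) {S : Set β} {u w : α} (p : G.Walk u w)
    (hp : ∀ z ∈ p.support, Disjoint (f z) S) {a b : β} (ha : a ∈ f u) (hb : b ∈ f w) :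
    ∃ q : T.Walk a b, ∀ z ∈ q.support, z ∉ S := by
  have single : ∀ v, Disjoint (f v) S → ∀ a ∈ f v, ∀ b ∈ f v,
      ∃ q : T.Walk a b, ∀ z ∈ q.support, z ∉ S := by
    intro v hv a ha b hb
    obtain ⟨q⟩ := (hf.1 v).preconnected ⟨a, ha⟩ ⟨b, hb⟩
    refine ⟨q.map (Embedding.induce (f v)).toHom, fun z hz ↦ ?_⟩
    obtain ⟨z', -, rfl⟩ := List.mem_map.1 (Walk.support_map _ q ▸ hz)
    exact hv.notMem_of_mem_left z'.2
  induction p generalizing a with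
  | nil => exact single _ (hp _ (by simp)) a ha b hb
  | @cons u v w h p ih =>
    obtain ⟨c, hcu, hcv⟩ := (hf.2 u v h.ne).1 h
    obtain ⟨q₁, hq₁⟩ := single u (hp _ (by simp)) a ha c hcu
    obtain ⟨q₂, hq₂⟩ := ih (fun z hz ↦ hp z (by simp [hz])) hcv hb
    refine ⟨q₁.append q₂, fun z hz ↦ ?_⟩
    rcases (Walk.mem_support_append_iff _ _).1 hz with h | h
    exacts [hq₁ z h, hq₂ z h]

/-- If the vertices `u i` are pairwise separated, each `u i` being avoidable from a common point
`w i` by walks to all others, then the host tree has at least as many leaves as there are indices. -/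
lemma card_le_numLeaves {α ι : Type*} [Finite β] {G : SimpleGraph α} {f : α → Set β}
    (hT : T.IsTree) (hf : IsSubtreeRep G T f) (u w : ι → α)
    (hself : ∀ i, u i ≠ w i ∧ ¬ G.Adj (u i) (w i))
    (hwalk : ∀ i j, i ≠ j → ∃ p : G.Walk (u j) (w i), ∀ z ∈ p.support, z ≠ u i ∧ ¬ G.Adj z (u i)) :
    Nat.card ι ≤ numLeaves T := by
  have hdisj : ∀ a b, a ≠ b → ¬ G.Adj a b → Disjoint (f a) (f b) := fun a b hne hadj ↦
    Set.disjoint_iff_inter_eq_empty.2 (Set.not_nonempty_iff_eq_empty.1 fun h ↦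
      hadj ((hf.2 a b hne).2 h))
  have hne : ∀ v, (f v).Nonempty := fun v ↦ Set.nonempty_coe_sort.1 (hf.1 v).nonempty
  choose y hy using fun i ↦ hne (w i)
  choose x hx hbar using fun i ↦ exists_isLeaf_of_barrier hT (hne (u i)) (y := y i)
    fun h ↦ (hdisj _ _ (hself i).1 (hself i).2).ne_of_mem h (hy i) rfl
  have hblock : ∀ i j, i ≠ j → ∀ a ∈ f (u j), ∀ p : T.Walk (x i) a,
      ∃ z ∈ p.support, z ∈ f (u i) := by
    intro i j hij a ha p
    obtain ⟨r, hr⟩ := hwalk i j hij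
    obtain ⟨q, hq⟩ := exists_walk_disjoint hf r
      (fun z hz ↦ hdisj z (u i) (hr z hz).1 (hr z hz).2) ha (hy i)
    obtain ⟨z, hz, hzS⟩ := hbar i (p.append q)
    rcases (Walk.mem_support_append_iff _ _).1 hz with h | h
    exacts [⟨z, h, hzS⟩, absurd hzS (hq z h)]
  have hinj : Function.Injective x := by
    intro i j hxij
    by_contra hij
    obtain ⟨a, ha⟩ := hne (u i)
    obtain ⟨p⟩ := hT.connected.preconnected (x i) a
    obtain ⟨r, hr⟩ := hwalk i j hij
    have hji := hr _ r.start_mem_support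
    refine false_of_mutual_barrier (hdisj _ _ hji.1.symm fun h ↦ hji.2 h.symm) ?_
      (hblock i j hij) _ a (.inl ha) p rfl
    rw [hxij]
    exact hblock j i (Ne.symm hij)
  calc Nat.card ι = (Set.range x).ncard := by
        rw [← Set.image_univ, Set.ncard_image_of_injective _ hinj, Set.ncard_univ]
    _ ≤ numLeaves T := Set.ncard_le_ncard (Set.range_subset_iff.2 hx) (Set.toFinite _)

end LowerBound

lemma isLeaf_iff_existsUnique {β : Type*} {T : SimpleGraph β} {v : β} :
    IsLeaf T v ↔ ∃! a, T.Adj v a := by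
  simp only [IsLeaf, Set.ncard_eq_one, Set.eq_singleton_iff_unique_mem]
  rfl

section Simplicial

variable {α : Type*} {G : SimpleGraph α}

lemma IsSimplicial.eq_of_adj (hG : G.IsAcyclic) {u a b : α} (hu : IsSimplicial G u)
    (ha : G.Adj u a) (hb : G.Adj u b) : a = b := by
  by_contra hne
  exact hG.not_adj_of_adj_of_adj ha hb (hu ha hb hne)

lemma isSimplicial_iff_subsingleton (hG : G.IsAcyclic) {u : α} :
    IsSimplicial G u ↔ (G.neighborSet u).Subsingleton :=
  ⟨fun hu _ ha _ hb ↦ hu.eq_of_adj hG ha hb, fun hu ↦ hu.pairwise _⟩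

lemma derivedGraph_reachable_of_isPath (hG : G.IsAcyclic) {a b : α} (p : G.Walk a b)
    (hp : p.IsPath) (ha : ¬ IsSimplicial G a) (hb : ¬ IsSimplicial G b) :
    (derivedGraph G).Reachable ⟨a, ha⟩ ⟨b, hb⟩ := by
  induction p with
  | nil => rfl
  | @cons a v b h p ih =>
    rw [Walk.cons_isPath_iff] at hp
    have hv : ¬ IsSimplicial G v := by
      intro hs
      cases p with
      | nil => exact hb hs
      | cons h' p' =>
        refine hp.2 ?_
        rw [hs.eq_of_adj hG h.symm h']
        simp
    have hadj : (derivedGraph G).Adj ⟨a, ha⟩ ⟨v, hv⟩ := h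
    exact hadj.reachable.trans (ih hp.1 hv hb)

lemma derivedGraph_preconnected (hG : G.IsTree) : (derivedGraph G).Preconnected := by
  rintro ⟨a, ha⟩ ⟨b, hb⟩
  obtain ⟨p, hp⟩ := hG.connected.exists_isPath a b
  exact derivedGraph_reachable_of_isPath hG.isAcyclic p hp ha hb

lemma exists_isSimplicial_adj_of_isLeaf (hG : G.IsAcyclic) {v : {v | ¬ IsSimplicial G v}}
    (hv : IsLeaf (derivedGraph G) v) : ∃ u, IsSimplicial G u ∧ G.Adj u v := by
  obtain ⟨w, -, hw⟩ := isLeaf_iff_existsUnique.1 hv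
  by_contra! hcon
  refine v.2 ((isSimplicial_iff_subsingleton hG).2 fun a ha b hb ↦ ?_)
  have key : ∀ c, G.Adj v c → c = w := fun c hc ↦
    congrArg Subtype.val (hw ⟨c, fun hs ↦ hcon c hs hc.symm⟩ hc)
  rw [key a ha, key b hb]

/-- Removing a leaf of the derived tree together with its pendant vertices keeps the rest of the
derived tree connected. -/
lemma exists_walk_avoiding_of_isLeaf (hG : G.IsTree) {v a b : {v | ¬ IsSimplicial G v}}
    (hv : IsLeaf (derivedGraph G) v) (ha : a ≠ v) (hb : b ≠ v) :
    ∃ p : G.Walk a b, ∀ z ∈ p.support, ¬ IsSimplicial G z ∧ z ≠ v := by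
  have : Fintype ((derivedGraph G).neighborSet v) :=
    (Set.finite_of_ncard_ne_zero (hv.trans_ne one_ne_zero)).fintype
  have hdeg : (derivedGraph G).degree v = 1 :=
    degree_eq_one_iff_existsUnique_adj.2 (isLeaf_iff_existsUnique.1 hv)
  have hconn : (derivedGraph G).Connected :=
    { preconnected := derivedGraph_preconnected hG, nonempty := ⟨v⟩ }
  obtain ⟨p⟩ := (hconn.induce_compl_singleton_of_degree_eq_one hdeg).preconnected ⟨a, ha⟩ ⟨b, hb⟩
  refine ⟨(p.map (Embedding.induce _).toHom).map (Embedding.induce _).toHom, fun z hz ↦ ?_⟩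
  obtain ⟨z, hz', rfl⟩ := List.mem_map.1 (Walk.support_map _ (p.map _) ▸ hz)
  obtain ⟨z, -, rfl⟩ := List.mem_map.1 (Walk.support_map _ p ▸ hz')
  exact ⟨z.1.2, fun h ↦ z.2 (Subtype.ext h)⟩

lemma numLeaves_derivedGraph_le (hG : G.IsTree) {β : Type*} [Finite β] {T : SimpleGraph β}
    {f : α → Set β} (hT : T.IsTree) (hf : IsSubtreeRep G T f) :
    numLeaves (derivedGraph G) ≤ numLeaves T := by
  choose u hu huv using fun i : {v | IsLeaf (derivedGraph G) v} ↦
    exists_isSimplicial_adj_of_isLeaf hG.isAcyclic i.2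
  choose w hw _ using fun i : {v | IsLeaf (derivedGraph G) v} ↦ isLeaf_iff_existsUnique.1 i.2
  have hadj : ∀ i z, G.Adj z (u i) → z = i := fun i z h ↦
    (hu i).eq_of_adj hG.isAcyclic h.symm (huv i)
  refine card_le_numLeaves hT hf u (fun i ↦ (w i : α)) (fun i ↦ ⟨?_, fun h ↦ ?_⟩) ?_
  · exact fun h ↦ (w i).2 (h ▸ hu i)
  · exact (hw i).ne (Subtype.ext (hadj i _ h.symm)).symm
  · intro i j hij
    have hji : (j : {v | ¬ IsSimplicial G v}) ≠ i := fun h ↦ hij (Subtype.ext h.symm)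
    obtain ⟨p, hp⟩ := exists_walk_avoiding_of_isLeaf hG i.2 hji (hw i).ne'
    refine ⟨.cons (huv j) p, fun z hz ↦ ?_⟩
    rw [Walk.support_cons, List.mem_cons] at hz
    rcases hz with rfl | hz
    · refine ⟨fun h ↦ hji (Subtype.ext (hadj i _ (h ▸ (huv j).symm))), fun h ↦ ?_⟩
      exact i.1.2 (hadj i _ h ▸ hu j)
    · exact ⟨fun h ↦ (hp z hz).1 (h ▸ hu i), fun h ↦ (hp z hz).2 (hadj i z h)⟩

lemma exists_not_isSimplicial_adj (hG : G.IsTree) {r : α} (hr : ¬ IsSimplicial G r) {u : α}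
    (hu : IsSimplicial G u) : ∃ v, ¬ IsSimplicial G v ∧ G.Adj u v := by
  have hne : u ≠ r := fun h ↦ hr (h ▸ hu)
  obtain ⟨p, hp⟩ := hG.connected.exists_isPath u r
  cases p with
  | nil => exact absurd rfl hne
  | @cons _ v _ h p =>
    refine ⟨v, fun hv ↦ ?_, h⟩
    rw [Walk.cons_isPath_iff] at hp
    cases p with
    | nil => exact hr hv
    | cons h' p' =>
      refine hp.2 ?_
      rw [hv.eq_of_adj hG.isAcyclic h.symm h']
      simp

end Simplicial

end Leafage

namespace SimpleGraph

/-- The graph joining every element other than `root` to its parent under `par`. -/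
def parentGraph {X : Type*} (root : X) (par : X → X) : SimpleGraph X :=
  fromRel fun x y ↦ x ≠ root ∧ par x = y

section ParentGraph

variable {X : Type*} {root : X} {par : X → X} {rank : X → ℕ}

lemma parentGraph_adj (hrank : ∀ x ≠ root, rank (par x) < rank x) {x y : X} :
    (parentGraph root par).Adj x y ↔ x ≠ root ∧ par x = y ∨ y ≠ root ∧ par y = x := by
  rw [parentGraph, fromRel_adj, and_iff_right_of_imp]
  rintro (⟨hx, rfl⟩ | ⟨hy, rfl⟩) h
  exacts [(hrank x hx).ne (congrArg rank h.symm), (hrank y hy).ne (congrArg rank h)]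

lemma parentGraph_adj_parent (hrank : ∀ x ≠ root, rank (par x) < rank x) {x : X} (hx : x ≠ root) :
    (parentGraph root par).Adj x (par x) :=
  (parentGraph_adj hrank).2 (.inl ⟨hx, rfl⟩)

lemma parentGraph_isTree [Finite X] (hrank : ∀ x ≠ root, rank (par x) < rank x) :
    (parentGraph root par).IsTree := by
  have hreach : ∀ n x, rank x = n → (parentGraph root par).Reachable x root := by
    intro n
    induction n using Nat.strong_induction_on with
    | _ n ih =>
      intro x hx
      by_cases hr : x = root
      · rw [hr]
      · exact (parentGraph_adj_parent hrank hr).reachable.trans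
          (ih _ (hx ▸ hrank x hr) _ rfl)
  have hconn : (parentGraph root par).Connected :=
    { preconnected := fun x y ↦ (hreach _ x rfl).trans (hreach _ y rfl).symm, nonempty := ⟨root⟩ }
  refine isTree_iff_connected_and_card.2
    ⟨hconn, le_antisymm ?_ hconn.card_vert_le_card_edgeSet_add_one⟩
  have hsub : (parentGraph root par).edgeSet ⊆ (fun x ↦ s(x, par x)) '' {root}ᶜ := by
    intro e
    induction e with
    | _ x y =>
      rw [mem_edgeSet, parentGraph_adj hrank]
      rintro (⟨hx, rfl⟩ | ⟨hy, rfl⟩)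
      exacts [⟨x, hx, rfl⟩, ⟨y, hy, Sym2.eq_swap⟩]
  have h1 := (Set.ncard_le_ncard hsub (Set.toFinite _)).trans (Set.ncard_image_le (Set.toFinite _))
  have h2 := Set.ncard_add_ncard_compl {root}
  rw [Set.ncard_singleton] at h2
  rw [Nat.card_coe_set_eq]
  omega

end ParentGraph

/-- A rooted tree has a parent function, decreasing the depth. -/
lemma IsTree.exists_parent {W : Type*} {H : SimpleGraph W} (hH : H.IsTree) (r : W) :
    ∃ (p : W → W) (depth : W → ℕ), (∀ v ≠ r, depth (p v) < depth v) ∧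
      ∀ v w, H.Adj v w ↔ v ≠ r ∧ p v = w ∨ w ≠ r ∧ p w = v := by
  have hex : ∀ v, ∃ w, v ≠ r → H.Adj v w ∧ H.dist w r < H.dist v r := by
    intro v
    obtain ⟨q, hq⟩ := hH.connected.exists_walk_length_eq_dist v r
    cases q with
    | nil => exact ⟨r, fun h ↦ absurd rfl h⟩
    | @cons _ w _ h q =>
      refine ⟨w, fun _ ↦ ⟨h, ?_⟩⟩
      have := dist_le q
      rw [Walk.length_cons] at hq
      omega
  choose p hp using hex
  have hpar : ∀ v w, H.Adj v w → H.dist w r < H.dist v r → v ≠ r ∧ p v = w := by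
    intro v w hadj hlt
    have hv : v ≠ r := by
      rintro rfl
      simp at hlt
    exact ⟨hv, hH.eq_of_adj_of_dist_lt (hp v hv).1 hadj (hp v hv).2 hlt⟩
  refine ⟨p, fun v ↦ H.dist v r, fun v hv ↦ (hp v hv).2, fun v w ↦ ⟨fun h ↦ ?_, ?_⟩⟩
  · exact (hH.dist_lt_or_gt_of_adj h r).symm.imp (hpar v w h) (hpar w v h.symm)
  · rintro (⟨hv, rfl⟩ | ⟨hw, rfl⟩)
    exacts [(hp v hv).1, (hp w hw).1.symm]

end SimpleGraph

namespace Leafage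

lemma exists_fin_isSubtreeRep {α β : Type*} [Finite β] {G : SimpleGraph α} {T : SimpleGraph β}
    {f : α → Set β} (hT : T.IsTree) (hf : IsSubtreeRep G T f) :
    ∃ (m : ℕ) (T' : SimpleGraph (Fin m)) (f' : α → Set (Fin m)),
      T'.IsTree ∧ IsSubtreeRep G T' f' ∧ numLeaves T' = numLeaves T := by
  have := Fintype.ofFinite β
  let e : T ≃g T.overFin rfl := T.overFinIso rfl
  refine ⟨_, _, fun v ↦ e '' f v, e.isTree_iff.1 hT, ⟨fun v ↦ ?_, fun u v huv ↦ ?_⟩, ?_⟩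
  · refine (hf.1 v).map (induceHom e.toHom (Set.mapsTo_image _ _)) ?_
    rintro ⟨_, x, hx, rfl⟩
    exact ⟨⟨x, hx⟩, rfl⟩
  · rw [← Set.image_inter e.injective, Set.image_nonempty, hf.2 u v huv]
  · have : {v | IsLeaf (T.overFin rfl) v} = e '' {v | IsLeaf T v} := by
      ext v
      obtain ⟨v, rfl⟩ := e.surjective v
      rw [e.injective.mem_set_image]
      simp only [Set.mem_ofPred_eq, isLeaf_iff_existsUnique]
      rw [e.bijective.existsUnique_iff]
      simp only [e.map_adj_iff]
    rw [numLeaves, this, Set.ncard_image_of_injective _ e.injective, numLeaves]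

section PathBlowup

variable {W : Type*} {N : ℕ} {p : W → W} {r : W} {depth : W → ℕ}

/-- The parent function on `W × Fin (N + 1)` in which every vertex of a rooted tree with parent
function `p` is replaced by a downward path, the top of each path hanging from the bottom of the
parent's path. -/
def blowupParent (N : ℕ) (p : W → W) (x : W × Fin (N + 1)) : W × Fin (N + 1) :=
  Fin.cases (p x.1, Fin.last N) (fun i ↦ (x.1, i.castSucc)) x.2

@[simp] lemma blowupParent_zero (v : W) : blowupParent N p (v, 0) = (p v, Fin.last N) := rfl

@[simp] lemma blowupParent_succ (v : W) (i : Fin N) :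
    blowupParent N p (v, i.succ) = (v, i.castSucc) := rfl

lemma blowupParent_rank_lt (hp : ∀ v ≠ r, depth (p v) < depth v) :
    ∀ x ≠ ((r, 0) : W × Fin (N + 1)),
      (N + 1) * depth (blowupParent N p x).1 + (blowupParent N p x).2 <
        (N + 1) * depth x.1 + x.2 := by
  rintro ⟨v, i⟩ hx
  cases i using Fin.cases with
  | zero =>
    have hv : v ≠ r := fun h ↦ hx (by rw [h])
    have := Nat.mul_le_mul_left (N + 1) (Nat.succ_le_of_lt (hp v hv))
    simp only [blowupParent_zero, Fin.val_last, Fin.val_zero]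
    rw [Nat.succ_eq_add_one, mul_add] at this
    omega
  | succ i => simp

/-- The tree obtained from a rooted tree by replacing every vertex by a path on `N + 1`
vertices. -/
abbrev blowup (N : ℕ) (p : W → W) (r : W) : SimpleGraph (W × Fin (N + 1)) :=
  parentGraph (r, 0) (blowupParent N p)

lemma blowup_adj_succ (hp : ∀ v ≠ r, depth (p v) < depth v) (v : W) (i : Fin N) :
    (blowup N p r).Adj (v, i.succ) (v, i.castSucc) :=
  parentGraph_adj_parent (rank := fun x ↦ (N + 1) * depth x.1 + x.2) (blowupParent_rank_lt hp)
    (x := (v, i.succ)) (by simp [Prod.ext_iff])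

lemma blowup_adj_zero (hp : ∀ v ≠ r, depth (p v) < depth v) {v : W} (hv : v ≠ r) :
    (blowup N p r).Adj (v, 0) (p v, Fin.last N) :=
  parentGraph_adj_parent (rank := fun x ↦ (N + 1) * depth x.1 + x.2) (blowupParent_rank_lt hp)
    (x := (v, 0)) (by simp [Prod.ext_iff, hv])

lemma blowup_isTree [Finite W] (hp : ∀ v ≠ r, depth (p v) < depth v) :
    (blowup N p r).IsTree :=
  parentGraph_isTree (rank := fun x ↦ (N + 1) * depth x.1 + x.2) (blowupParent_rank_lt hp)

/-- The subtree of `blowup N p r` consisting of the path of `v` and the tops of the paths of its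
children. -/
def blowupBag (N : ℕ) (p : W → W) (r v : W) : Set (W × Fin (N + 1)) :=
  {x | x.1 = v ∨ x.2 = 0 ∧ x.1 ≠ r ∧ p x.1 = v}

lemma isSubtree_blowupBag (hp : ∀ v ≠ r, depth (p v) < depth v) (v : W) :
    IsSubtree (blowup N p r) (blowupBag N p r v) := by
  have hmem : ∀ i, (v, i) ∈ blowupBag N p r v := fun i ↦ .inl rfl
  have hpath : ∀ i, ((blowup N p r).induce (blowupBag N p r v)).Reachable
      ⟨(v, i), hmem i⟩ ⟨(v, 0), hmem 0⟩ := by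
    intro i
    induction i using Fin.induction with
    | zero => rfl
    | succ i ih =>
      have : ((blowup N p r).induce (blowupBag N p r v)).Adj
        ⟨(v, i.succ), hmem _⟩ ⟨(v, i.castSucc), hmem _⟩ := blowup_adj_succ hp v i
      exact this.reachable.trans ih
  have hreach : ∀ x, ((blowup N p r).induce (blowupBag N p r v)).Reachable x
      ⟨(v, 0), hmem 0⟩ := by
    rintro ⟨⟨w, i⟩, hx⟩
    have hx' := hx
    rcases hx' with rfl | ⟨rfl, hw, rfl⟩
    · exact hpath i
    · have : ((blowup N p r).induce (blowupBag N p r (p w))).Adj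
        ⟨(w, 0), hx⟩ ⟨(p w, Fin.last N), hmem _⟩ := blowup_adj_zero hp hw
      exact this.reachable.trans (hpath _)
  exact { preconnected := fun x y ↦ (hreach x).trans (hreach y).symm
          nonempty := ⟨⟨(v, 0), hmem 0⟩⟩ }

lemma numLeaves_blowup_le [Finite W] {H : SimpleGraph W} (hp : ∀ v ≠ r, depth (p v) < depth v)
    (hadj : ∀ v w, H.Adj v w ↔ v ≠ r ∧ p v = w ∨ w ≠ r ∧ p w = v) (hr : IsLeaf H r) :
    numLeaves (blowup N p r) ≤ numLeaves H := by
  have hrank := blowupParent_rank_lt (N := N) hp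
  have hchild : ∀ x y, IsLeaf (blowup N p r) x → x ≠ (r, 0) → y ≠ (r, 0) →
      blowupParent N p y ≠ x := by
    rintro x y hx hxr hyr rfl
    have h1 := parentGraph_adj_parent
      (rank := fun x : W × Fin (N + 1) ↦ (N + 1) * depth x.1 + x.2) hrank hxr
    have h2 := parentGraph_adj_parent
      (rank := fun x : W × Fin (N + 1) ↦ (N + 1) * depth x.1 + x.2) hrank hyr
    have h3 := (isLeaf_iff_existsUnique.1 hx).unique h1 h2.symm
    have h4 := hrank _ hxr
    have h5 := hrank _ hyr
    rw [h3] at h4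
    omega
  have hlast : ∀ x, IsLeaf (blowup N p r) x → x ≠ (r, 0) → x.2 = Fin.last N := by
    rintro ⟨v, i⟩ hx hxr
    cases i using Fin.lastCases with
    | last => rfl
    | cast i => exact absurd rfl (hchild _ (v, i.succ) hx hxr (by simp [Prod.ext_iff]))
  have hbottom : ∀ x, IsLeaf (blowup N p r) x → x ≠ (r, 0) → ∀ w ≠ r, p w ≠ x.1 := by
    rintro ⟨v, i⟩ hx hxr w hw rfl
    obtain rfl : i = Fin.last N := hlast _ hx hxr
    exact hchild _ (w, 0) hx hxr (by simp [Prod.ext_iff, hw]) rfl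
  have hroot : ∀ x, IsLeaf (blowup N p r) x → x ≠ (r, 0) → x.1 ≠ r := by
    intro x hx hxr h
    obtain ⟨w, hw, -⟩ := isLeaf_iff_existsUnique.1 hr
    rcases (hadj r w).1 hw with h' | ⟨hwr, hw⟩
    exacts [h'.1 rfl, hbottom x hx hxr w hwr (hw.trans h.symm)]
  refine Set.ncard_le_ncard_of_injOn Prod.fst (fun x hx ↦ ?_) (fun x hx y hy hxy ↦ ?_)
    (Set.toFinite _)
  · by_cases hxr : x = (r, 0)
    · rw [hxr]
      exact hr
    · refine isLeaf_iff_existsUnique.2 ⟨p x.1, (hadj _ _).2 (.inl ⟨hroot x hx hxr, rfl⟩), ?_⟩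
      intro w hw
      rcases (hadj _ _).1 hw with h | h
      exacts [h.2.symm, absurd h.2 (hbottom x hx hxr w h.1)]
  · by_cases hxr : x = (r, 0) <;> by_cases hyr : y = (r, 0)
    · rw [hxr, hyr]
    · exact absurd (hxy.symm.trans (congrArg Prod.fst hxr)) (hroot y hy hyr)
    · exact absurd (hxy.trans (congrArg Prod.fst hyr)) (hroot x hx hxr)
    · exact Prod.ext hxy ((hlast x hx hxr).trans (hlast y hy hyr).symm)

end PathBlowup

/-- A tree is represented in a blowup of its derived tree, each pendant vertex being assigned a
single point on the path of its neighbor. -/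
lemma isSubtreeRep_blowup {α : Type*} {G : SimpleGraph α} (hG : G.IsTree) {N : ℕ}
    {idx : α → Fin N} (hidx : Function.Injective idx)
    {p : {v | ¬ IsSimplicial G v} → {v | ¬ IsSimplicial G v}} {r : {v | ¬ IsSimplicial G v}}
    {depth : {v | ¬ IsSimplicial G v} → ℕ} (hp : ∀ v ≠ r, depth (p v) < depth v)
    (hadj : ∀ v w, (derivedGraph G).Adj v w ↔ v ≠ r ∧ p v = w ∨ w ≠ r ∧ p w = v) :
    IsSubtreeRep G (blowup N p r) fun v ↦
      {x | (x.1 : α) = v ∨ (x.2 = 0 ∧ x.1 ≠ r ∧ (p x.1 : α) = v) ∨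
        (IsSimplicial G v ∧ G.Adj v x.1 ∧ x.2 = (idx v).succ)} := by
  refine ⟨fun v ↦ ?_, fun u v huv ↦ ⟨fun h ↦ ?_, ?_⟩⟩
  · by_cases hv : IsSimplicial G v
    · obtain ⟨w, hw, hvw⟩ := exists_not_isSimplicial_adj hG r.2 hv
      have hpt : ∀ x : {v | ¬ IsSimplicial G v} × Fin (N + 1),
          ((x.1 : α) = v ∨ (x.2 = 0 ∧ x.1 ≠ r ∧ (p x.1 : α) = v) ∨
            (IsSimplicial G v ∧ G.Adj v x.1 ∧ x.2 = (idx v).succ)) →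
          x = (⟨w, hw⟩, (idx v).succ) := by
        rintro x (h | ⟨-, -, h⟩ | ⟨-, h, h'⟩)
        · exact absurd (h ▸ hv) x.1.2
        · exact absurd (h ▸ hv) (p x.1).2
        · exact Prod.ext (Subtype.ext (hv.eq_of_adj hG.isAcyclic h hvw)) h'
      exact { preconnected := fun x y ↦ by
                rw [Subtype.ext ((hpt _ x.2).trans (hpt _ y.2).symm)]
              nonempty := ⟨⟨(⟨w, hw⟩, (idx v).succ), .inr (.inr ⟨hv, hvw, rfl⟩)⟩⟩ }
    · convert isSubtree_blowupBag (N := N) hp ⟨v, hv⟩ using 1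
      ext x
      simp [blowupBag, hv, Subtype.ext_iff]
  · by_cases hu : IsSimplicial G u
    · obtain ⟨w, hw, huw⟩ := exists_not_isSimplicial_adj hG r.2 hu
      obtain rfl := hu.eq_of_adj hG.isAcyclic huw h
      exact ⟨(⟨w, hw⟩, (idx u).succ), .inr (.inr ⟨hu, h, rfl⟩), .inl rfl⟩
    by_cases hv : IsSimplicial G v
    · exact ⟨(⟨u, hu⟩, (idx v).succ), .inl rfl, .inr (.inr ⟨hv, h.symm, rfl⟩)⟩
    rcases (hadj ⟨u, hu⟩ ⟨v, hv⟩).1 h with ⟨hr, h⟩ | ⟨hr, h⟩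
    · exact ⟨(⟨u, hu⟩, 0), .inl rfl, .inr (.inl ⟨rfl, hr, congrArg Subtype.val h⟩)⟩
    · exact ⟨(⟨v, hv⟩, 0), .inr (.inl ⟨rfl, hr, congrArg Subtype.val h⟩), .inl rfl⟩
  · have hpadj : ∀ w ≠ r, G.Adj w (p w) := fun w hw ↦ (hadj w (p w)).2 (.inl ⟨hw, rfl⟩)
    rintro ⟨x, rfl | ⟨h0, hxr, rfl⟩ | ⟨hu, hux, hui⟩, rfl | ⟨h0', hxr', rfl⟩ | ⟨hv, hvx, hvi⟩⟩
    · exact absurd rfl huv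
    · exact hpadj _ hxr'
    · exact hvx.symm
    · exact (hpadj _ hxr).symm
    · exact absurd rfl huv
    · exact absurd (hvi.symm.trans h0) (Fin.succ_ne_zero _)
    · exact hux
    · exact absurd (hui.symm.trans h0') (Fin.succ_ne_zero _)
    · exact absurd (hidx (Fin.succ_injective _ (hui.symm.trans hvi))) huv

end Leafage

theorem stmt2 {V : Type*} [Fintype V] (G : SimpleGraph V) (hT : G.IsTree)
    (hstar : ¬ ({v | 1 < (G.neighborSet v).ncard} : Set V).Subsingleton) :
    leafage G = numLeaves (derivedGraph G) := by
  classical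
  have hnonsimp : ∀ v, 1 < (G.neighborSet v).ncard → ¬ IsSimplicial G v := fun v hv hs ↦
    hv.not_ge (Set.ncard_le_one_iff_subsingleton.2
      ((isSimplicial_iff_subsingleton hT.isAcyclic).1 hs))
  obtain ⟨a, ha, b, hb, hab⟩ := Set.not_subsingleton_iff.1 hstar
  have hnt : Nontrivial {v | ¬ IsSimplicial G v} :=
    ⟨⟨a, hnonsimp a ha⟩, ⟨b, hnonsimp b hb⟩, fun h ↦ hab (congrArg Subtype.val h)⟩
  have hH : (derivedGraph G).IsTree :=
    { preconnected := derivedGraph_preconnected hT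
      nonempty := inferInstance
      isAcyclic := hT.isAcyclic.induce _ }
  obtain ⟨r, hr⟩ := hH.exists_vert_degree_one_of_nontrivial
  have hr : IsLeaf (derivedGraph G) r :=
    isLeaf_iff_existsUnique.2 (degree_eq_one_iff_existsUnique_adj.1 hr)
  obtain ⟨p, depth, hp, hadj⟩ := hH.exists_parent r
  have hrep := isSubtreeRep_blowup hT (Fintype.equivFin V).injective hp hadj
  have hmem := exists_fin_isSubtreeRep (blowup_isTree hp) hrep
  refine le_antisymm ((Nat.sInf_le hmem).trans (numLeaves_blowup_le hp hadj hr)) ?_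
  refine le_csInf ⟨_, hmem⟩ ?_
  rintro _ ⟨m, T, f, hTree, hf, rfl⟩
  exact numLeaves_derivedGraph_le hT hTree hf
end

section
/- In a k-tree that is not a clique, the simplicial vertices are exactly the vertices of degree k, and the simplicial vertices form an independent set. -/
open SimpleGraph

namespace Leafage

variable {V : Type*}

/-- A numbering `d` of the vertices of `G`, starting from `0`, in which the vertices numbered
below `k` form a clique and each later vertex has exactly `k` earlier neighbors, forming a
clique. -/
structure IsKTreeNumbering (k : ℕ) (G : SimpleGraph V) (d : V → ℕ) : Prop where
  injective : Function.Injective d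
  range_eq : Set.range d = Set.Iio (Nat.card V)
  adj_of_lt : ∀ u v, d u < k → d v < k → u ≠ v → G.Adj u v
  isClique : ∀ v, k ≤ d v → G.IsClique {u | G.Adj v u ∧ d u < d v}
  ncard_eq : ∀ v, k ≤ d v → {u | G.Adj v u ∧ d u < d v}.ncard = k

theorem IsKTree.exists_numbering {k : ℕ} {G : SimpleGraph V} (h : IsKTree k G) :
    ∃ d, IsKTreeNumbering k G d := by
  obtain ⟨n, e, -, hadj, hback⟩ := h
  have hn : Nat.card V = n := by simpa using (Nat.card_congr e).symm
  have hset (v : V) : {u | G.Adj (e (e.symm v)) u ∧ ∃ j, j < e.symm v ∧ e j = u} =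
      {u | G.Adj v u ∧ (e.symm u : ℕ) < e.symm v} := by
    ext u
    simp only [Equiv.apply_symm_apply, Set.mem_ofPred_eq]
    refine and_congr_right fun _ => ⟨?_, fun hu => ⟨e.symm u, hu, by simp⟩⟩
    rintro ⟨j, hj, rfl⟩
    simpa using hj
  refine ⟨fun v => (e.symm v : ℕ),
    Fin.val_injective.comp e.symm.injective, ?_, ?_, ?_, ?_⟩
  · ext m
    simp only [Set.mem_range, Set.mem_Iio, hn]
    constructor
    · rintro ⟨v, rfl⟩
      exact (e.symm v).isLt
    · intro hm
      exact ⟨e ⟨m, hm⟩, by simp⟩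
  · intro u v hu hv huv
    simpa using hadj (e.symm u) (e.symm v) hu hv (by simpa using huv)
  · intro v hv
    have := (hback (e.symm v) hv).1
    rwa [hset] at this
  · intro v hv
    have := (hback (e.symm v) hv).2
    rwa [hset] at this

namespace IsKTreeNumbering

variable {k m : ℕ} {G : SimpleGraph V} {d : V → ℕ} {u v w : V}

theorem lt_card (h : IsKTreeNumbering k G d) (v : V) : d v < Nat.card V := by
  have : d v ∈ Set.range d := ⟨v, rfl⟩
  rwa [h.range_eq] at this

theorem ncard_setOf_lt (h : IsKTreeNumbering k G d) (hm : m ≤ Nat.card V) :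
    {v | d v < m}.ncard = m := by
  have himage : d '' {v | d v < m} = Set.Iio m := by
    ext i
    constructor
    · rintro ⟨v, hv, rfl⟩
      exact hv
    · intro hi
      have : i ∈ Set.range d := by
        rw [h.range_eq]
        exact lt_of_lt_of_le hi hm
      obtain ⟨v, rfl⟩ := this
      exact ⟨v, hi, rfl⟩
  rw [← Set.ncard_image_of_injective _ h.injective, himage, Set.ncard_eq_toFinset_card']
  simp

theorem ncard_setOf_le_diff (h : IsKTreeNumbering k G d) (hk : k < Nat.card V) (hv : d v ≤ k) :
    ({u | d u < k + 1} \ {v}).ncard = k := by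
  rw [Set.ncard_sdiff_singleton_of_mem (by simpa [Nat.lt_succ_iff] using hv),
    h.ncard_setOf_lt hk, Nat.succ_sub_one]

variable [Finite V]

theorem adj_of_le (h : IsKTreeNumbering k G d) (hu : d u ≤ k) (hv : d v ≤ k) (huv : u ≠ v) :
    G.Adj u v := by
  wlog hlt : d u < d v generalizing u v
  · have hne := h.injective.ne huv
    exact (this hv hu huv.symm (by omega)).symm
  rcases hv.lt_or_eq with hvk | hvk
  · exact h.adj_of_lt u v (hlt.trans hvk) hvk huv
  · have hB : {x | G.Adj v x ∧ d x < d v} = {x | d x < d v} :=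
      Set.eq_of_subset_of_ncard_le (fun x hx => hx.2) <| by
        rw [h.ncard_eq v hvk.ge, h.ncard_setOf_lt (h.lt_card v).le, hvk]
    have hmem : u ∈ {x | G.Adj v x ∧ d x < d v} := hB ▸ hlt
    exact hmem.1.symm

theorem le_ncard_adj_lt (h : IsKTreeNumbering k G d) (hm : k < m) (hmc : m ≤ Nat.card V)
    (hv : d v < m) : k ≤ {u | G.Adj v u ∧ d u < m}.ncard := by
  rcases le_or_gt (d v) k with hvk | hvk
  · rw [← h.ncard_setOf_le_diff (hm.trans_le hmc) hvk]
    refine Set.ncard_le_ncard fun u ⟨hu, huv⟩ => ?_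
    simp only [Set.mem_ofPred_eq] at hu
    exact ⟨h.adj_of_le hvk (by omega) (Ne.symm huv), by omega⟩
  · rw [← h.ncard_eq v hvk.le]
    exact Set.ncard_le_ncard fun u hu => ⟨hu.1, hu.2.trans hv⟩

theorem exists_adj_not_adj (h : IsKTreeNumbering k G d) (hkw : k < d w) (hvw : d v < d w)
    (hadj : G.Adj v w) : ∃ x, G.Adj v x ∧ d x < d w ∧ ¬ G.Adj w x := by
  by_contra! hx
  have hle := h.le_ncard_adj_lt hkw (h.lt_card w).le hvw
  have hlt : {u | G.Adj v u ∧ d u < d w}.ncard < {u | G.Adj w u ∧ d u < d w}.ncard :=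
    Set.ncard_lt_ncard ⟨fun u hu => ⟨hx u hu.1 hu.2, hu.2⟩,
      fun hsub => G.irrefl (hsub (show v ∈ _ from ⟨hadj.symm, hvw⟩)).1⟩
  rw [h.ncard_eq w hkw.le] at hlt
  omega

theorem not_isSimplicial_of_adj (h : IsKTreeNumbering k G d) (hkw : k < d w) (hvw : d v < d w)
    (hadj : G.Adj v w) : ¬ IsSimplicial G v := by
  obtain ⟨x, hvx, hxw, hwx⟩ := h.exists_adj_not_adj hkw hvw hadj
  exact fun hs => hwx (hs hadj hvx (by rintro rfl; exact hxw.false))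

theorem lt_ncard_neighborSet_of_adj (h : IsKTreeNumbering k G d) (hkw : k < d w)
    (hvw : d v < d w) (hadj : G.Adj v w) : k < (G.neighborSet v).ncard :=
  (h.le_ncard_adj_lt hkw (h.lt_card w).le hvw).trans_lt <|
    Set.ncard_lt_ncard ⟨fun _ hu => hu.1, fun hsub => (hsub hadj).2.false⟩

theorem isSimplicial_and_ncard_neighborSet (h : IsKTreeNumbering k G d) (hk : k < Nat.card V)
    (hv : ∀ w, k < d w → d v < d w → ¬ G.Adj v w) :
    IsSimplicial G v ∧ (G.neighborSet v).ncard = k := by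
  rcases le_or_gt (d v) k with hvk | hvk
  · have hN : G.neighborSet v = {u | d u < k + 1} \ {v} := by
      ext u
      constructor
      · intro hu
        refine ⟨?_, hu.ne'⟩
        by_contra hku
        simp only [Set.mem_ofPred_eq] at hku
        exact hv u (by omega) (by omega) hu
      · rintro ⟨hu, huv⟩
        exact h.adj_of_le hvk (Nat.lt_succ_iff.1 hu) (Ne.symm huv)
    rw [IsSimplicial, hN]
    exact ⟨fun x hx y hy hxy => h.adj_of_le (Nat.lt_succ_iff.1 hx.1)
      (Nat.lt_succ_iff.1 hy.1) hxy, h.ncard_setOf_le_diff hk hvk⟩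
  · have hN : G.neighborSet v = {u | G.Adj v u ∧ d u < d v} := by
      ext u
      refine ⟨fun hu => ⟨hu, ?_⟩, fun hu => hu.1⟩
      have hne := h.injective.ne hu.ne
      by_contra hvu
      exact hv u (by omega) (by omega) hu
    rw [IsSimplicial, hN]
    exact ⟨h.isClique v hvk.le, h.ncard_eq v hvk.le⟩

theorem succ_lt_card (h : IsKTreeNumbering k G d) (hG : G ≠ ⊤) :
    k + 1 < Nat.card V := by
  by_contra hlt
  refine hG (eq_top_iff.2 fun u v huv => ?_)
  have hu := h.lt_card u
  have hv := h.lt_card v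
  exact h.adj_of_le (by omega) (by omega) huv

theorem isSimplicial_iff (h : IsKTreeNumbering k G d) (hk : k < Nat.card V) :
    IsSimplicial G v ↔ (G.neighborSet v).ncard = k := by
  by_cases hv : ∃ w, k < d w ∧ d v < d w ∧ G.Adj v w
  · obtain ⟨w, hkw, hvw, hadj⟩ := hv
    exact iff_of_false (h.not_isSimplicial_of_adj hkw hvw hadj)
      (h.lt_ncard_neighborSet_of_adj hkw hvw hadj).ne'
  · push Not at hv
    exact iff_of_true (h.isSimplicial_and_ncard_neighborSet hk hv).1
      (h.isSimplicial_and_ncard_neighborSet hk hv).2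

theorem not_adj_of_isSimplicial (h : IsKTreeNumbering k G d) (hk : k + 1 < Nat.card V)
    (hu : IsSimplicial G u) (hv : IsSimplicial G v) : ¬ G.Adj u v := by
  intro hadj
  wlog huv : d u < d v generalizing u v
  · have hne := h.injective.ne hadj.ne
    exact this hv hu hadj.symm (by omega)
  have hvk : d v ≤ k := not_lt.1 fun hvk => h.not_isSimplicial_of_adj hvk huv hadj hu
  obtain ⟨w, hw⟩ : k + 1 ∈ Set.range d := by
    rw [h.range_eq]
    exact hk
  have huw : ¬ G.Adj w u := fun hwu =>
    h.not_isSimplicial_of_adj (by omega) (by omega) hwu.symm hu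
  have hvw : ¬ G.Adj w v := fun hwv =>
    h.not_isSimplicial_of_adj (by omega) (by omega) hwv.symm hv
  have hlt : {x | G.Adj w x ∧ d x < d w}.ncard < ({x | d x < k + 1} \ {v}).ncard :=
    Set.ncard_lt_ncard ⟨fun x hx => ⟨hw ▸ hx.2, by rintro rfl; exact hvw hx.1⟩,
      fun hsub => huw (hsub (show u ∈ _ from
        ⟨show d u < k + 1 by omega, hadj.ne⟩)).1⟩
  rw [h.ncard_eq w (by omega), h.ncard_setOf_le_diff (by omega) hvk] at hlt
  exact hlt.false

end IsKTreeNumbering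

end Leafage

open SimpleGraph Leafage

theorem stmt3 {V : Type*} [Fintype V] (k : ℕ) (G : SimpleGraph V)
    (hk : IsKTree k G) (hnc : G ≠ ⊤) :
    (∀ v, IsSimplicial G v ↔ (G.neighborSet v).ncard = k) ∧
    (∀ u v, IsSimplicial G u → IsSimplicial G v → ¬ G.Adj u v) := by
  obtain ⟨d, hd⟩ := hk.exists_numbering
  have hcard := hd.succ_lt_card hnc
  exact ⟨fun v => hd.isSimplicial_iff (by omega), fun u v => hd.not_adj_of_isSimplicial hcard⟩
end

section
/- If G is a k-tree that is not a clique and G has at least two distinct simplicial neighborhoods, then G has two distinct simplicial neighborhoods neither of which is a cutset of the derived graph G'. -/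
open SimpleGraph

open SimpleGraph Leafage

/-- Deleting a vertex whose remaining neighborhood is a clique preserves connectedness. -/
lemma preconnected_induce_diff_singleton {V : Type*} {G : SimpleGraph V} {A : Set V} {v : V}
    (hA : (G.induce A).Preconnected) (hv : G.IsClique (G.neighborSet v ∩ A)) :
    (G.induce (A \ {v})).Preconnected := by
  rintro ⟨x, hxA, hxv⟩ ⟨y, hyA, hyv⟩
  have key : ∀ z : A, Relation.ReflTransGen (G.induce A).Adj ⟨x, hxA⟩ z →
      (∀ h : z.1 ≠ v, (G.induce (A \ {v})).Reachable ⟨x, hxA, hxv⟩ ⟨z.1, z.2, h⟩) ∧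
      (z.1 = v → ∃ w, ∃ h : w ∈ A \ {v}, G.Adj v w ∧
        (G.induce (A \ {v})).Reachable ⟨x, hxA, hxv⟩ ⟨w, h⟩) := by
    intro z hz
    induction hz with
    | refl => exact ⟨fun _ => Reachable.refl _, fun h => absurd h hxv⟩
    | @tail b c _ hbc ih =>
      have hbc' : G.Adj b.1 c.1 := hbc
      refine ⟨fun hc => ?_, fun hc => ?_⟩
      · by_cases hb : b.1 = v
        · obtain ⟨w, hw, hvw, hr⟩ := ih.2 hb
          by_cases hwc : w = c.1
          · subst hwc
            exact hr
          · refine hr.trans (Adj.reachable ?_)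
            exact hv ⟨hvw, hw.1⟩ ⟨by simpa [hb] using hbc', c.2⟩ hwc
        · exact (ih.1 hb).trans (Adj.reachable hbc')
      · have hb : b.1 ≠ v := fun hb => hbc'.ne (hb.trans hc.symm)
        exact ⟨b.1, ⟨b.2, hb⟩, hc ▸ hbc'.symm, ih.1 hb⟩
  exact (key ⟨y, hyA⟩ ((reachable_iff_reflTransGen _ _).1 (hA _ _))).1 hyv

/-- Deleting a finite set of simplicial vertices preserves connectedness. -/
lemma preconnected_induce_diff_of_isSimplicial {V : Type*} {G : SimpleGraph V} {A S : Set V}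
    (hS : S.Finite) (hA : (G.induce A).Preconnected) (h : ∀ v ∈ S, IsSimplicial G v) :
    (G.induce (A \ S)).Preconnected := by
  induction S, hS using Set.Finite.induction_on with
  | empty => rwa [Set.sdiff_empty]
  | @insert v S _ _ ih =>
    have hAS : A \ insert v S = (A \ S) \ {v} := by
      ext w
      simp only [Set.mem_sdiff, Set.mem_insert_iff, Set.mem_singleton_iff]
      tauto
    rw [hAS]
    exact preconnected_induce_diff_singleton (ih fun w hw => h w (Or.inr hw))
      ((h v (Or.inl rfl)).subset Set.inter_subset_left)

/-- Deleting fewer than `k` vertices from a `k`-tree leaves a connected graph. -/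
lemma preconnected_induce_compl_of_isKTree {V : Type*} {G : SimpleGraph V} {k : ℕ} {T : Set V}
    (hG : IsKTree k G) (hTfin : T.Finite) (hT : T.ncard < k) :
    (G.induce Tᶜ).Preconnected := by
  obtain ⟨n, e, hkn, hbase, hstep⟩ := hG
  obtain ⟨r, hr, hrT⟩ : ∃ r : Fin n, (r : ℕ) < k ∧ e r ∉ T := by
    by_contra! hcon
    let g : Fin k ↪ V := (Fin.castLEEmb hkn).trans e.toEmbedding
    have hsub : Set.range g ⊆ T := by
      rintro _ ⟨i, rfl⟩
      exact hcon (Fin.castLE hkn i) i.2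
    have := Set.ncard_le_ncard hsub hTfin
    rw [← Set.image_univ, Set.ncard_image_of_injective _ g.injective, Set.ncard_univ,
      Nat.card_fin] at this
    omega
  have key : ∀ i : Fin n, ∀ hi : e i ∉ T, (G.induce Tᶜ).Reachable ⟨e r, hrT⟩ ⟨e i, hi⟩ := by
    intro i
    induction i using WellFoundedLT.induction with
    | ind i ih =>
      intro hi
      by_cases hik : (i : ℕ) < k
      · by_cases hri : r = i
        · subst hri
          exact Reachable.refl _
        · exact Adj.reachable (hbase r i hr hik hri)
      · obtain ⟨-, hcard⟩ := hstep i (not_lt.1 hik)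
        obtain ⟨w, ⟨hw, j, hj, rfl⟩, hwT⟩ :=
          Set.exists_mem_notMem_of_ncard_lt_ncard (hcard ▸ hT) hTfin
        exact (ih j hj hwT).trans (Adj.reachable hw.symm)
  rintro ⟨x, hx⟩ ⟨y, hy⟩
  obtain ⟨i, rfl⟩ := e.surjective x
  obtain ⟨j, rfl⟩ := e.surjective y
  exact (key i hx).symm.trans (key j hy)

/-- A simplicial vertex of a `k`-tree has degree at most `k`. -/
lemma ncard_neighborSet_le_of_isSimplicial {V : Type*} {G : SimpleGraph V} {k : ℕ}
    (hG : IsKTree k G) {u : V} (hu : IsSimplicial G u) : (G.neighborSet u).ncard ≤ k := by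
  obtain ⟨n, e, hkn, -, hstep⟩ := hG
  have : Finite V := .of_equiv _ e
  have hQ : G.IsClique (insert u (G.neighborSet u)) := hu.insert fun _ h _ => h
  have hcard : (insert u (G.neighborSet u)).ncard = (G.neighborSet u).ncard + 1 :=
    Set.ncard_insert_of_notMem (by simp)
  suffices (insert u (G.neighborSet u)).ncard ≤ k + 1 by omega
  obtain ⟨m, hm, hmax⟩ := Set.exists_max_image (insert u (G.neighborSet u)) e.symm
    (Set.toFinite _) ⟨u, Set.mem_insert _ _⟩
  by_cases hmk : k ≤ (e.symm m : ℕ)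
  · obtain ⟨-, h⟩ := hstep _ hmk
    rw [e.apply_symm_apply] at h
    rw [← h]
    refine (Set.ncard_le_ncard (t := insert m _) ?_).trans (Set.ncard_insert_le _ _)
    intro w hw
    by_cases hwm : w = m
    · exact Or.inl hwm
    · exact Or.inr ⟨hQ hm hw (Ne.symm hwm), e.symm w,
        lt_of_le_of_ne (hmax w hw) (e.symm.injective.ne hwm), e.apply_symm_apply w⟩
  · have hle : (insert u (G.neighborSet u)).ncard ≤ (Set.Iio k).ncard := by
      refine Set.ncard_le_ncard_of_injOn (fun w => (e.symm w : ℕ)) ?_ ?_ (Set.finite_Iio k)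
      · intro w hw
        have : (e.symm w : ℕ) ≤ e.symm m := hmax w hw
        exact lt_of_le_of_lt this (not_le.1 hmk)
      · intro x _ y _ hxy
        exact e.symm.injective (Fin.ext hxy)
    rw [Set.ncard_Iio_nat] at hle
    omega

/-- In a graph with a perfect elimination ordering `f`, every vertex set that is not a clique
induces a subgraph with two nonadjacent simplicial vertices. -/
lemma exists_nonadj_simplicial {V : Type*} {G : SimpleGraph V} (f : V → ℕ)
    (hf : Function.Injective f) (hpeo : ∀ v, G.IsClique {w | G.Adj v w ∧ f w < f v})
    {W : Set V} (hfin : W.Finite) (hW : ¬ G.IsClique W) :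
    ∃ a ∈ W, ∃ b ∈ W, a ≠ b ∧ ¬ G.Adj a b ∧
      G.IsClique (G.neighborSet a ∩ W) ∧ G.IsClique (G.neighborSet b ∩ W) := by
  induction hn : W.ncard generalizing W with
  | zero =>
    rw [Set.ncard_eq_zero hfin] at hn
    exact absurd (hn ▸ isClique_empty) hW
  | succ n ih =>
    obtain ⟨w, hwW, hmax⟩ := Set.exists_max_image W f hfin
      (Set.nonempty_of_ncard_ne_zero (by omega))
    have hw : G.IsClique (G.neighborSet w ∩ W) := by
      refine (hpeo w).subset fun x hx => ?_
      exact ⟨hx.1, lt_of_le_of_ne (hmax x hx.2) (hf.ne (Adj.ne hx.1).symm)⟩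
    have extend : ∀ a, ¬ G.Adj a w → G.IsClique (G.neighborSet a ∩ (W \ {w})) →
        G.IsClique (G.neighborSet a ∩ W) := by
      refine fun a haw ha => ha.subset fun x hx => ?_
      exact ⟨hx.1, hx.2, fun h => haw (by rw [← Set.mem_singleton_iff.1 h]; exact hx.1)⟩
    by_cases hcl : G.IsClique (W \ {w})
    · obtain ⟨x, hxW, hxw, hadj⟩ : ∃ x ∈ W, x ≠ w ∧ ¬ G.Adj x w := by
        by_contra! hcon
        refine hW ?_
        rw [← Set.insert_sdiff_self_of_mem hwW]
        exact hcl.insert fun b hb _ => (hcon b hb.1 hb.2).symm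
      exact ⟨x, hxW, w, hwW, hxw, hadj, extend x hadj (hcl.subset Set.inter_subset_right), hw⟩
    · obtain ⟨a, ha, b, hb, hab, hnadj, hsa, hsb⟩ := ih hfin.sdiff hcl
        (by rw [Set.ncard_sdiff_singleton_of_mem hwW]; omega)
      by_cases haw : G.Adj a w
      · have hbw : ¬ G.Adj b w := fun hbw => hnadj (hw ⟨haw.symm, ha.1⟩ ⟨hbw.symm, hb.1⟩ hab)
        exact ⟨b, hb.1, w, hwW, hb.2, hbw, extend b hbw hsb, hw⟩
      · exact ⟨a, ha.1, w, hwW, ha.2, haw, extend a haw hsa, hw⟩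

/-- A set is no cutset of the derived graph if deleting it together with all simplicial vertices
leaves a connected graph. -/
lemma not_isCutset_derivedGraph {V : Type*} {G : SimpleGraph V} {S : Set V}
    (h : (G.induce ({v | ¬ IsSimplicial G v} \ S)).Preconnected) :
    ¬ IsCutset (derivedGraph G) (Subtype.val ⁻¹' S) := by
  rintro ⟨-, hn⟩
  refine hn fun x y => ?_
  let φ : G.induce ({v | ¬ IsSimplicial G v} \ S) →g
      (derivedGraph G).induce (Subtype.val ⁻¹' S)ᶜ :=
    ⟨fun z => ⟨⟨z.1, z.2.1⟩, z.2.2⟩, fun {_ _} hab => hab⟩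
  exact (h ⟨x.1.1, x.1.2, x.2⟩ ⟨y.1.1, y.1.2, y.2⟩).map φ

/-- In a `k`-tree, a simplicial neighborhood containing a simplicial vertex of the derived graph
is not a cutset of the derived graph. -/
lemma not_isCutset_neighborSet {V : Type*} [Finite V] {G : SimpleGraph V} {k : ℕ}
    (hG : IsKTree k G) {u a : V} (hu : IsSimplicial G u) (hua : G.Adj u a)
    (ha : G.IsClique (G.neighborSet a ∩ {v | ¬ IsSimplicial G v})) :
    ¬ IsCutset (derivedGraph G) (Subtype.val ⁻¹' G.neighborSet u) := by
  have hcard : (G.neighborSet u \ {a}).ncard < k :=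
    (Set.ncard_sdiff_singleton_lt_of_mem hua).trans_le (ncard_neighborSet_le_of_isSimplicial hG hu)
  have hconn := preconnected_induce_diff_singleton (v := a)
    (preconnected_induce_diff_of_isSimplicial (S := {v | IsSimplicial G v}) (Set.toFinite _)
      (preconnected_induce_compl_of_isKTree hG (Set.toFinite _) hcard) fun _ h => h)
    (ha.subset (Set.inter_subset_inter_right _ fun _ hx => hx.2))
  refine not_isCutset_derivedGraph ?_
  convert hconn using 2
  all_goals
    ext x
    have : x = a → x ∈ G.neighborSet u := fun h => h ▸ hua
    simp only [Set.mem_sdiff, Set.mem_compl_iff, Set.mem_ofPred_eq, Set.mem_singleton_iff]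
    tauto

/-- A non-simplicial vertex that is simplicial in the derived graph has a simplicial neighbor. -/
lemma exists_isSimplicial_adj {V : Type*} {G : SimpleGraph V} {a : V}
    (ha : ¬ IsSimplicial G a) (ha' : G.IsClique (G.neighborSet a ∩ {v | ¬ IsSimplicial G v})) :
    ∃ u, IsSimplicial G u ∧ G.Adj u a := by
  by_contra! hcon
  refine ha (ha'.subset fun x hx => ?_)
  exact ⟨hx, fun h => hcon x h (Adj.symm hx)⟩

theorem stmt4 {V : Type*} [Fintype V] (k : ℕ) (G : SimpleGraph V)
    (hk : IsKTree k G) (hnc : G ≠ ⊤)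
    (h2 : ∃ u v, IsSimplicial G u ∧ IsSimplicial G v ∧ G.neighborSet u ≠ G.neighborSet v) :
    ∃ u v, IsSimplicial G u ∧ IsSimplicial G v ∧ G.neighborSet u ≠ G.neighborSet v ∧
      ¬ IsCutset (derivedGraph G) (Subtype.val ⁻¹' G.neighborSet u) ∧
      ¬ IsCutset (derivedGraph G) (Subtype.val ⁻¹' G.neighborSet v) := by
  by_cases hcl : G.IsClique {v | ¬ IsSimplicial G v}
  · have hcut : ∀ S : Set V, ¬ IsCutset (derivedGraph G) (Subtype.val ⁻¹' S) := fun S =>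
      not_isCutset_derivedGraph fun x y => by
        by_cases hxy : x = y
        · rw [hxy]
        · exact Adj.reachable (hcl x.2.1 y.2.1 (Subtype.coe_injective.ne hxy))
    obtain ⟨u, v, hu, hv, huv⟩ := h2
    exact ⟨u, v, hu, hv, huv, hcut _, hcut _⟩
  · have hpeo : ∃ f : V → ℕ, Function.Injective f ∧
        ∀ v, G.IsClique {w | G.Adj v w ∧ f w < f v} := by
      obtain ⟨n, e, -, hbase, hstep⟩ := hk
      refine ⟨fun v => e.symm v, fun x y h => e.symm.injective (Fin.ext h), fun v => ?_⟩
      by_cases hv : k ≤ (e.symm v : ℕ)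
      · refine (hstep _ hv).1.subset fun w hw => ?_
        exact ⟨by simpa using hw.1, e.symm w, hw.2, e.apply_symm_apply w⟩
      · intro x hx y hy hxy
        have := hbase (e.symm x) (e.symm y) (hx.2.trans (not_le.1 hv)) (hy.2.trans (not_le.1 hv))
          (e.symm.injective.ne hxy)
        simpa using this
    obtain ⟨f, hf, hpeo⟩ := hpeo
    obtain ⟨a, ha, b, hb, hab, hnadj, hsa, hsb⟩ :=
      exists_nonadj_simplicial f hf hpeo (Set.toFinite _) hcl
    obtain ⟨u, hu, hua⟩ := exists_isSimplicial_adj ha hsa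
    obtain ⟨v, hv, hvb⟩ := exists_isSimplicial_adj hb hsb
    refine ⟨u, v, hu, hv, fun h => hnadj (hu hua ?_ hab), not_isCutset_neighborSet hk hu hua hsa,
      not_isCutset_neighborSet hk hv hvb hsb⟩
    rw [h]
    exact hvb
end

section
/- If G is a k-tree that is not a clique, then l(G) = max{2, r(G)}, where r(G) is the number of distinct simplicial neighborhoods of G that are not cutsets of the derived graph G'. -/
open SimpleGraph

namespace Leafage

variable {V : Type*}

/-- In a tree, every walk between two distinct neighbors of `a` passes through `a`. -/
lemma mem_support_of_adj_of_adj {W : Type*} {T : SimpleGraph W} (hT : T.IsTree) {a x y : W}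
    (hx : T.Adj a x) (hy : T.Adj a y) (hxy : x ≠ y) (p : T.Walk x y) : a ∈ p.support := by
  by_contra ha
  have hb := isAcyclic_iff_forall_adj_isBridge.1 hT.isAcyclic hx
  rw [isBridge_iff_forall_walk_mem_edges] at hb
  have hmem := hb ((Walk.nil.cons hy).append p.reverse)
  rw [Walk.edges_append, List.mem_append] at hmem
  rcases hmem with h | h
  · simp at h
    rcases h with h | h
    · exact hxy h
    · exact hx.ne h.2.symm
  · rw [Walk.edges_reverse, List.mem_reverse] at h
    exact ha (p.fst_mem_support_of_mem_edges h)

/-- A vertex other than the root that is not a leaf has a neighbor strictly further away from the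
root, all of whose walks to the root go through the vertex. -/
lemma exists_adj_forall_walk_mem_support {W : Type*} {T : SimpleGraph W}
    (hT : T.IsTree) {a r : W} (har : a ≠ r) (ha : ¬ IsLeaf T a) :
    ∃ z, T.Adj a z ∧ ∀ p : T.Walk z r, a ∈ p.support := by
  by_contra! hcon
  apply ha
  obtain ⟨p⟩ := hT.connected a r
  cases p with
  | nil => exact absurd rfl har
  | @cons _ x _ hx q =>
    rw [IsLeaf, Set.ncard_eq_one]
    refine ⟨x, Set.eq_singleton_iff_unique_mem.2 ⟨hx, fun y hy => ?_⟩⟩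
    by_contra hyx
    obtain ⟨p1, h1⟩ := hcon x hx
    obtain ⟨p2, h2⟩ := hcon y hy
    have := mem_support_of_adj_of_adj hT hy hx hyx (p2.append p1.reverse)
    rw [Walk.mem_support_append_iff, Walk.support_reverse, List.mem_reverse] at this
    tauto

lemma dist_lt_of_forall_walk_mem_support {W : Type*} {T : SimpleGraph W} (hT : T.IsTree)
    {a z r : W} (haz : T.Adj a z) (h : ∀ p : T.Walk z r, a ∈ p.support) :
    T.dist a r < T.dist z r := by
  classical
  obtain ⟨p, hp⟩ := (hT.connected z r).exists_walk_length_eq_dist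
  have ha := h p
  have hlen := congrArg Walk.length (p.take_spec ha)
  rw [Walk.length_append] at hlen
  have h1 : T.dist a r ≤ (p.dropUntil a ha).length := dist_le _
  have h2 : (p.takeUntil a ha).length ≠ 0 := fun h0 => haz.ne (Walk.eq_of_length_eq_zero h0).symm
  omega

/-- Every nonempty set `D` of vertices of a finite tree that avoids `r` and is closed under passing
to the far side of its vertices, as seen from `r`, contains a leaf. -/
lemma exists_isLeaf_mem {W : Type*} [Finite W] {T : SimpleGraph W} (hT : T.IsTree) {r : W}
    {D : Set W} (hD : D.Nonempty) (hr : r ∉ D)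
    (hcl : ∀ a ∈ D, ∀ z, T.Adj a z → (∀ p : T.Walk z r, a ∈ p.support) → z ∈ D) :
    ∃ a ∈ D, IsLeaf T a := by
  obtain ⟨a, haD, hmax⟩ := D.toFinite.exists_maximalFor (fun x => T.dist x r) D hD
  refine ⟨a, haD, ?_⟩
  by_contra hleaf
  obtain ⟨z, haz, hz⟩ := exists_adj_forall_walk_mem_support hT (r := r)
    (by rintro rfl; exact hr haD) hleaf
  have hlt := dist_lt_of_forall_walk_mem_support hT haz hz
  have := hmax (hcl a haD z haz hz) hlt.le
  exact absurd this (not_le.2 hlt)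

/-- A finite tree with at least two vertices has at least two leaves. -/
lemma two_le_numLeaves {W : Type*} [Finite W] [Nontrivial W] {T : SimpleGraph W}
    (hT : T.IsTree) : 2 ≤ numLeaves T := by
  have key : ∀ r, ∃ a, a ≠ r ∧ IsLeaf T a := by
    intro r
    obtain ⟨b, hb⟩ := exists_ne r
    obtain ⟨a, ha, hl⟩ := exists_isLeaf_mem hT (r := r) (D := {r}ᶜ) ⟨b, hb⟩ (by simp)
      (by
        rintro a ha z - hz rfl
        exact ha (by simpa using hz Walk.nil))
    exact ⟨a, ha, hl⟩
  obtain ⟨a, -, ha⟩ := key (Classical.arbitrary W)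
  obtain ⟨b, hba, hb⟩ := key a
  have := Set.ncard_pair hba
  rw [numLeaves, ← this]
  exact Set.ncard_le_ncard (by rintro x (rfl | rfl) <;> assumption) (Set.toFinite _)

/-- `a` and `b` are joined by a walk of `T` avoiding the set `S`. -/
def JoinedOff {W : Type*} (T : SimpleGraph W) (S : Set W) (a b : W) : Prop :=
  ∃ p : T.Walk a b, ∀ w ∈ p.support, w ∉ S

namespace JoinedOff

variable {W : Type*} {T : SimpleGraph W} {S : Set W} {a b c : W}

lemma trans : JoinedOff T S a b → JoinedOff T S b c → JoinedOff T S a c := by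
  rintro ⟨p, hp⟩ ⟨q, hq⟩
  refine ⟨p.append q, fun w hw => ?_⟩
  rw [Walk.mem_support_append_iff] at hw
  exact hw.elim (hp w) (hq w)

lemma symm : JoinedOff T S a b → JoinedOff T S b a := by
  rintro ⟨p, hp⟩
  exact ⟨p.reverse, fun w hw => hp w (by simpa using hw)⟩

lemma of_isSubtree {F : Set W} (hF : IsSubtree T F) (hd : Disjoint F S) (ha : a ∈ F)
    (hb : b ∈ F) : JoinedOff T S a b := by
  obtain ⟨p⟩ := hF.preconnected ⟨a, ha⟩ ⟨b, hb⟩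
  refine ⟨p.map (Embedding.induce F).toHom, fun w hw hS => ?_⟩
  have hw' : w ∈ (p.map (Embedding.induce F).toHom).support := hw
  rw [Walk.support_map, List.mem_map] at hw'
  obtain ⟨x, -, rfl⟩ := hw'
  exact Set.disjoint_left.1 hd x.2 hS

end JoinedOff

/-- A walk meeting `A ∪ B` at its end meets one of these sets before the other. -/
lemma exists_joinedOff_of_walk {W : Type*} {T : SimpleGraph W} {A B : Set W} (hd : Disjoint A B)
    {a b : W} (p : T.Walk a b) (hb : b ∈ A) :
    (∃ c ∈ A, JoinedOff T B a c) ∨ ∃ c ∈ B, JoinedOff T A a c := by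
  induction p with
  | @nil u => exact .inl ⟨u, hb, .nil, by simpa using Set.disjoint_left.1 hd hb⟩
  | @cons u v w h q ih =>
    by_cases hA : u ∈ A
    · exact .inl ⟨u, hA, .nil, by simpa using Set.disjoint_left.1 hd hA⟩
    by_cases hB : u ∈ B
    · exact .inr ⟨u, hB, .nil, by simpa using hA⟩
    rcases ih hb with ⟨c, hc, p, hp⟩ | ⟨c, hc, p, hp⟩
    · exact .inl ⟨c, hc, .cons h p, by simpa [hB] using hp⟩
    · exact .inr ⟨c, hc, .cons h p, by simpa [hA] using hp⟩

/-- If pairwise disjoint subtrees are such that the complement of each one has the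
others in one component, then there are at least as many leaves as subtrees. -/
lemma card_le_numLeaves_of_joinedOff {W ι : Type*} [Finite W] [Finite ι] [Nontrivial ι]
    {T : SimpleGraph W} (hT : T.IsTree) (F : ι → Set W) (hF : ∀ i, IsSubtree T (F i))
    (hd : ∀ i j, i ≠ j → Disjoint (F i) (F j)) (q : ι → W) (hq : ∀ i, q i ∈ F i)
    (hj : ∀ i j l, j ≠ i → l ≠ i → JoinedOff T (F i) (q j) (q l)) :
    Nat.card ι ≤ numLeaves T := by
  have key : ∀ i, ∃ a, IsLeaf T a ∧ ∀ j, j ≠ i → ¬ JoinedOff T (F i) a (q j) := by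
    intro i
    obtain ⟨j, hji⟩ := exists_ne i
    obtain ⟨a, ha, hl⟩ := exists_isLeaf_mem hT (r := q j)
      (D := {a | ¬ JoinedOff T (F i) a (q j)})
      ⟨q i, fun ⟨p, hp⟩ => hp _ p.start_mem_support (hq i)⟩
      (fun h => h (.of_isSubtree (hF j) (hd j i hji) (hq j) (hq j)))
      (by
        classical
        rintro a ha z haz hz ⟨p, hp⟩
        have hap := hz p
        exact ha ⟨p.dropUntil a hap, fun w hw => hp w (p.support_dropUntil_subset_support hap hw)⟩)
    exact ⟨a, hl, fun l hl h => ha (h.trans (hj i l j hl hji))⟩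
  choose L hleaf hL using key
  have hinj : Function.Injective L := by
    intro i j hij
    by_contra hne
    obtain ⟨p⟩ := hT.connected (L i) (q i)
    rcases exists_joinedOff_of_walk (hd i j hne) p (hq i) with ⟨c, hc, h⟩ | ⟨c, hc, h⟩
    · rw [hij] at h
      exact hL j i hne (h.trans (.of_isSubtree (hF i) (hd i j hne) hc (hq i)))
    · exact hL i j (Ne.symm hne) (h.trans (.of_isSubtree (hF j) (hd j i (Ne.symm hne)) hc (hq j)))
  rw [numLeaves, ← Set.ncard_univ, ← Set.ncard_image_of_injective _ hinj]
  exact Set.ncard_le_ncard (by rintro _ ⟨i, -, rfl⟩; exact hleaf i) (Set.toFinite _)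

section ParentGraph

variable {N : Type*}

/-- The graph joining each element `v` other than the root `r` to its parent `p v`. -/
def parentGraph (p : N → N) (r : N) : SimpleGraph N :=
  fromRel fun u v => u ≠ r ∧ p u = v

variable {p : N → N} {r : N} {α : Type*} [Preorder α] {μ : N → α}

lemma parentGraph_adj (hμ : ∀ v, v ≠ r → μ (p v) < μ v) {v : N} (hv : v ≠ r) :
    (parentGraph p r).Adj v (p v) := by
  rw [parentGraph, fromRel_adj]
  refine ⟨fun h => ?_, .inl ⟨hv, rfl⟩⟩
  have := hμ v hv
  rw [← h] at this
  exact lt_irrefl _ this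

lemma induce_parentGraph_connected [WellFoundedLT α] (hμ : ∀ v, v ≠ r → μ (p v) < μ v)
    {S : Set N} {s : N} (hs : s ∈ S) (hS : ∀ v ∈ S, v ≠ s → v ≠ r ∧ p v ∈ S) :
    ((parentGraph p r).induce S).Connected := by
  rw [connected_iff_exists_forall_reachable]
  refine ⟨⟨s, hs⟩, ?_⟩
  have key : ∀ x : α, ∀ v (hv : v ∈ S), μ v = x →
      ((parentGraph p r).induce S).Reachable ⟨s, hs⟩ ⟨v, hv⟩ := by
    intro x
    induction x using WellFoundedLT.induction with
    | ind x ih =>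
      rintro v hv rfl
      by_cases hvs : v = s
      · subst hvs; rfl
      obtain ⟨hr, hp⟩ := hS v hv hvs
      refine (ih _ (hμ v hr) (p v) hp rfl).trans (Adj.reachable ?_)
      exact (parentGraph_adj hμ hr).symm
  exact fun w => key _ w.1 w.2 rfl

lemma parentGraph_isTree [Finite N] [WellFoundedLT α] (hμ : ∀ v, v ≠ r → μ (p v) < μ v) :
    (parentGraph p r).IsTree := by
  have hconn : (parentGraph p r).Connected := by
    have := induce_parentGraph_connected hμ (S := Set.univ) (Set.mem_univ r)
      (fun v _ hv => ⟨hv, Set.mem_univ _⟩)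
    exact (induceUnivIso _).connected_iff.1 this
  rw [isTree_iff_connected_and_card]
  refine ⟨hconn, le_antisymm ?_ hconn.card_vert_le_card_edgeSet_add_one⟩
  have hsub : (parentGraph p r).edgeSet ⊆ (fun v => s(v, p v)) '' {r}ᶜ := by
    intro e
    induction e using Sym2.ind with
    | _ u v =>
      rw [mem_edgeSet, parentGraph, fromRel_adj]
      rintro ⟨-, ⟨h, rfl⟩ | ⟨h, rfl⟩⟩
      · exact ⟨u, h, rfl⟩
      · exact ⟨v, h, Sym2.eq_swap⟩
  have h1 := Set.ncard_le_ncard hsub (Set.toFinite _)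
  have h2 := Set.ncard_image_le (f := fun v => s(v, p v)) (Set.toFinite ({r}ᶜ : Set N))
  have h3 := Set.ncard_add_ncard_compl ({r} : Set N)
  rw [Set.ncard_singleton] at h3
  rw [Nat.card_coe_set_eq]
  omega

lemma not_isLeaf_of_adj_of_adj [Finite N] {T : SimpleGraph N} {a x y : N} (hx : T.Adj a x)
    (hy : T.Adj a y) (hxy : x ≠ y) : ¬ IsLeaf T a := by
  intro h
  rw [IsLeaf, Set.ncard_eq_one] at h
  obtain ⟨z, hz⟩ := h
  have h1 : x ∈ T.neighborSet a := hx
  have h2 : y ∈ T.neighborSet a := hy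
  rw [hz] at h1 h2
  exact hxy (h1.trans h2.symm)

/-- A leaf other than the root is not a parent. -/
lemma parent_ne_of_isLeaf [Finite N] (hμ : ∀ v, v ≠ r → μ (p v) < μ v) {a v : N}
    (ha : IsLeaf (parentGraph p r) a) (har : a ≠ r) (hv : v ≠ r) : p v ≠ a := by
  rintro rfl
  refine not_isLeaf_of_adj_of_adj (parentGraph_adj hμ hv).symm (parentGraph_adj hμ har) ?_ ha
  intro h
  have h1 := hμ _ hv
  have h2 := hμ _ har
  rw [← h] at h2
  exact lt_asymm h1 h2

end ParentGraph


section BuildTime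

variable {V : Type*}

/-- The neighbors of `v` that are strictly earlier than `v` with respect to `t`. -/
def earlierNbrs (G : SimpleGraph V) (t : V → ℕ) (v : V) : Set V :=
  {u | G.Adj v u ∧ t u < t v}

/-- A building process of a `k`-tree from a `k`-clique `B` to which at least two vertices are
attached, in which only the times `t` of adjacent vertices outside `B` need to be distinct. -/
structure IsBuildTime (k : ℕ) (G : SimpleGraph V) (B : Set V) (t : V → ℕ) : Prop where
  ncard_base : B.ncard = k
  isClique_base : G.IsClique B
  eq_zero_iff : ∀ v, t v = 0 ↔ v ∈ B
  ne_of_adj : ∀ u v, G.Adj u v → v ∉ B → t u ≠ t v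
  isClique : ∀ v, v ∉ B → G.IsClique (earlierNbrs G t v)
  ncard : ∀ v, v ∉ B → (earlierNbrs G t v).ncard = k
  exists_pair : ∃ u v, u ≠ v ∧ u ∉ B ∧ v ∉ B ∧ earlierNbrs G t u = B ∧ earlierNbrs G t v = B

lemma IsKTree.exists_isBuildTime [Finite V] {k : ℕ} {G : SimpleGraph V} (hk : IsKTree k G)
    (hnc : G ≠ ⊤) : ∃ B t, IsBuildTime k G B t := by
  classical
  obtain ⟨n, e, hkn, hbase, hstep⟩ := hk
  have hcard : ∀ l : ℕ, l ≤ n → {v | ∃ j : Fin n, (j : ℕ) < l ∧ e j = v}.ncard = l := by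
    intro l hl
    have : {v | ∃ j : Fin n, (j : ℕ) < l ∧ e j = v} =
        Set.range fun j : Fin l => e (Fin.castLE hl j) := by
      ext v
      constructor
      · rintro ⟨j, hj, rfl⟩
        exact ⟨⟨j, hj⟩, rfl⟩
      · rintro ⟨j, rfl⟩
        exact ⟨_, j.2, rfl⟩
    rw [this, ← Set.image_univ, Set.ncard_image_of_injective, Set.ncard_univ, Nat.card_fin]
    exact e.injective.comp (Fin.castLE_injective hl)
  have hlt : ∀ i j : Fin n, (i : ℕ) ≤ k → j < i → G.Adj (e i) (e j) := by
    intro i j hi hji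
    rcases hi.lt_or_eq with hi | hi
    · exact hbase i j hi (lt_trans hji hi) hji.ne'
    · have heq := Set.eq_of_subset_of_ncard_le
        (s := {v | G.Adj (e i) v ∧ ∃ j, j < i ∧ e j = v})
        (t := {v | ∃ j : Fin n, (j : ℕ) < k ∧ e j = v})
        (by rintro _ ⟨-, j, hj, rfl⟩; exact ⟨j, hi ▸ hj, rfl⟩)
        (by rw [hcard k hkn, (hstep i hi.ge).2]) (Set.toFinite _)
      have : e j ∈ {v | ∃ j : Fin n, (j : ℕ) < k ∧ e j = v} := ⟨j, hi ▸ hji, rfl⟩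
      rw [← heq] at this
      exact this.1
  have hclq : ∀ i j : Fin n, (i : ℕ) ≤ k → (j : ℕ) ≤ k → i ≠ j → G.Adj (e i) (e j) := by
    intro i j hi hj hij
    rcases lt_or_gt_of_ne hij with h | h
    · exact (hlt j i hj h).symm
    · exact hlt i j hi h
  have hn : k + 1 < n := by
    by_contra hn
    apply hnc
    ext u v
    rw [top_adj]
    refine ⟨G.ne_of_adj, fun huv => ?_⟩
    have := hclq (e.symm u) (e.symm v) (by omega) (by omega) (by simpa using huv)
    simpa using this
  set i₁ : Fin n := ⟨k + 1, hn⟩ with hi₁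
  set B : Set V := {v | G.Adj (e i₁) v ∧ ∃ j, j < i₁ ∧ e j = v} with hB
  have hBle : ∀ j : Fin n, e j ∈ B → (j : ℕ) ≤ k := by
    rintro j ⟨-, l, hl, hle⟩
    rw [← e.injective hle]
    exact Nat.lt_succ_iff.1 hl
  have hBcard : B.ncard = k := (hstep i₁ (Nat.le_succ k)).2
  obtain ⟨m, hm⟩ : ∃ m, {v | ∃ j : Fin n, (j : ℕ) < k + 1 ∧ e j = v} \ B = {m} := by
    rw [← Set.ncard_eq_one, Set.ncard_sdiff, hcard _ hn.le, hBcard, Nat.add_sub_cancel_left]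
    · rintro _ ⟨-, j, hj, rfl⟩
      exact ⟨j, hj, rfl⟩
  have hm' : ∀ j : Fin n, (j : ℕ) ≤ k → e j ∉ B → e j = m := by
    intro j hj hjB
    have : e j ∈ ({m} : Set V) := hm ▸ ⟨⟨j, Nat.lt_succ_of_le hj, rfl⟩, hjB⟩
    exact this
  set t : V → ℕ := fun v => if v ∈ B then 0 else (e.symm v : ℕ) + 1 with ht
  have htB : ∀ v, v ∈ B → t v = 0 := fun v hv => if_pos hv
  have htN : ∀ j, e j ∉ B → t (e j) = j + 1 := fun j hj => by simp [ht, hj]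
  have hearly : ∀ i : Fin n, k < i →
      earlierNbrs G t (e i) = {v | G.Adj (e i) v ∧ ∃ j, j < i ∧ e j = v} := by
    intro i hi
    have hiB : e i ∉ B := fun h => absurd (hBle i h) (not_le.2 hi)
    ext v
    obtain ⟨j, rfl⟩ := e.surjective v
    simp only [earlierNbrs, Set.mem_ofPred_eq, htN i hiB]
    refine and_congr_right fun _ => ?_
    by_cases hjB : e j ∈ B
    · rw [htB _ hjB]
      exact iff_of_true (Nat.succ_pos _) ⟨j, Fin.lt_def.2 (lt_of_le_of_lt (hBle j hjB) hi), rfl⟩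
    · rw [htN j hjB]
      constructor
      · intro h
        exact ⟨j, Nat.lt_of_succ_lt_succ h, rfl⟩
      · rintro ⟨l, hl, hle⟩
        rw [← e.injective hle]
        exact Nat.succ_lt_succ hl
  have hmem : m ∈ {v | ∃ j : Fin n, (j : ℕ) < k + 1 ∧ e j = v} \ B := by rw [hm]; rfl
  obtain ⟨⟨l, hl, hlm⟩, hmB⟩ := hmem
  have hearlym : earlierNbrs G t m = B := by
    ext v
    obtain ⟨j, rfl⟩ := e.surjective v
    rw [← hlm] at hmB ⊢
    simp only [earlierNbrs, Set.mem_ofPred_eq]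
    constructor
    · rintro ⟨hadj, hlt'⟩
      by_contra hjB
      rw [htN j hjB, htN l hmB] at hlt'
      have := hm' j (by omega) hjB
      rw [← hlm] at this
      exact hadj.ne this.symm
    · intro hjB
      refine ⟨hclq l j (by omega) (hBle j hjB) ?_, ?_⟩
      · rintro rfl
        exact hmB hjB
      · rw [htB _ hjB, htN l hmB]
        exact Nat.succ_pos _
  have hBclq : G.IsClique B := (hstep i₁ (Nat.le_succ k)).1
  have hcase : ∀ v, v ∉ B → v = m ∨ ∃ i : Fin n, k < i ∧ e i = v := by
    intro v hv
    obtain ⟨j, rfl⟩ := e.surjective v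
    by_cases hj : (j : ℕ) ≤ k
    · exact .inl (hm' j hj hv)
    · exact .inr ⟨j, not_le.1 hj, rfl⟩
  refine ⟨B, t, hBcard, hBclq, ?_, ?_, ?_, ?_, m, e i₁, ?_, hmB, ?_, hearlym,
    hearly i₁ (Nat.lt_succ_self k)⟩
  · intro v
    by_cases hv : v ∈ B <;> simp [ht, hv]
  · intro u v huv hv
    obtain ⟨i, rfl⟩ := e.surjective u
    obtain ⟨j, rfl⟩ := e.surjective v
    rw [htN j hv]
    by_cases hu : e i ∈ B
    · rw [htB _ hu]
      exact (Nat.succ_ne_zero _).symm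
    · rw [htN i hu]
      intro h
      exact huv.ne (congrArg e (Fin.ext (Nat.succ_injective h)))
  · intro v hv
    rcases hcase v hv with rfl | ⟨i, hi, rfl⟩
    · rwa [hearlym]
    · rw [hearly i hi]
      exact (hstep i hi.le).1
  · intro v hv
    rcases hcase v hv with rfl | ⟨i, hi, rfl⟩
    · rwa [hearlym]
    · rw [hearly i hi]
      exact (hstep i hi.le).2
  · rw [← hlm]
    intro h
    have := congrArg Fin.val (e.injective h)
    rw [hi₁] at this
    simp only at this
    omega
  · intro h
    have := hBle _ h
    rw [hi₁] at this
    simp only at this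
    omega

namespace IsBuildTime

variable {k : ℕ} {G : SimpleGraph V} {B : Set V} {t : V → ℕ}

lemma mem_or_mem_of_adj (h : IsBuildTime k G B t) {u v : V} (hv : v ∉ B) (huv : G.Adj u v) :
    u ∈ earlierNbrs G t v ∨ v ∈ earlierNbrs G t u := by
  rcases lt_or_gt_of_ne (h.ne_of_adj u v huv hv) with hlt | hlt
  · exact .inl ⟨huv.symm, hlt⟩
  · exact .inr ⟨huv, hlt⟩

lemma not_mem_of_mem_earlierNbrs (h : IsBuildTime k G B t) {u v : V}
    (hu : u ∈ earlierNbrs G t v) : v ∉ B := by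
  rw [← h.eq_zero_iff]
  exact Nat.ne_of_gt (lt_of_le_of_lt (Nat.zero_le _) hu.2)

lemma not_isSimplicial_of_mem_base (h : IsBuildTime k G B t) {v : V} (hv : v ∈ B) :
    ¬ IsSimplicial G v := by
  intro hs
  obtain ⟨a, b, hab, ha, hb, hea, heb⟩ := h.exists_pair
  have hav : v ∈ earlierNbrs G t a := hea ▸ hv
  have hbv : v ∈ earlierNbrs G t b := heb ▸ hv
  rcases h.mem_or_mem_of_adj hb (hs hav.1.symm hbv.1.symm hab) with h' | h'
  · exact ha (heb ▸ h')
  · exact hb (hea ▸ h')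

lemma not_mem_base_of_isSimplicial (h : IsBuildTime k G B t) {v : V} (hv : IsSimplicial G v) :
    v ∉ B := fun hB => h.not_isSimplicial_of_mem_base hB hv

lemma neighborSet_eq_of_forall (h : IsBuildTime k G B t) {v : V} (hv : v ∉ B)
    (hlast : ∀ w, v ∉ earlierNbrs G t w) : G.neighborSet v = earlierNbrs G t v := by
  ext w
  refine ⟨fun hw => ?_, fun hw => hw.1⟩
  exact (h.mem_or_mem_of_adj hv (G.adj_symm hw)).resolve_right (hlast w)

lemma exists_mem_of_not_isSimplicial (h : IsBuildTime k G B t) {v : V} (hv : v ∉ B)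
    (hs : ¬ IsSimplicial G v) : ∃ w, v ∈ earlierNbrs G t w := by
  by_contra! hcon
  apply hs
  rw [IsSimplicial, h.neighborSet_eq_of_forall hv hcon]
  exact h.isClique v hv

variable [Finite V]

/-- A vertex having a later neighbor is not simplicial. -/
lemma not_isSimplicial_of_mem (h : IsBuildTime k G B t) {u v : V}
    (hu : u ∈ earlierNbrs G t v) : ¬ IsSimplicial G u := by
  by_cases huB : u ∈ B
  · exact h.not_isSimplicial_of_mem_base huB
  intro hs
  have hsub : insert u (earlierNbrs G t u) ⊆ earlierNbrs G t v := by
    rw [Set.insert_subset_iff]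
    refine ⟨hu, fun w hw => ?_⟩
    have hwt : t w < t v := hw.2.trans hu.2
    exact ⟨hs hu.1.symm hw.1 (by rintro rfl; exact lt_irrefl _ hwt), hwt⟩
  have := Set.ncard_le_ncard hsub (Set.toFinite _)
  rw [Set.ncard_insert_of_notMem (fun hm => lt_irrefl _ hm.2) (Set.toFinite _), h.ncard u huB,
    h.ncard v (h.not_mem_of_mem_earlierNbrs hu)] at this
  omega

lemma neighborSet_eq (h : IsBuildTime k G B t) {v : V} (hv : IsSimplicial G v) :
    G.neighborSet v = earlierNbrs G t v :=
  h.neighborSet_eq_of_forall (h.not_mem_base_of_isSimplicial hv)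
    fun _ hw => h.not_isSimplicial_of_mem hw hv

lemma ncard_neighborSet (h : IsBuildTime k G B t) {v : V} (hv : IsSimplicial G v) :
    (G.neighborSet v).ncard = k := by
  rw [h.neighborSet_eq hv, h.ncard v (h.not_mem_base_of_isSimplicial hv)]

lemma not_isSimplicial_of_adj (h : IsBuildTime k G B t) {u v : V} (hv : IsSimplicial G v)
    (huv : G.Adj v u) : ¬ IsSimplicial G u := by
  have : u ∈ G.neighborSet v := huv
  rw [h.neighborSet_eq hv] at this
  exact h.not_isSimplicial_of_mem this

/-- If the non-simplicial vertices outside `R` that belong to the base or are attached to `R`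
form a clique, then `R` is not a cutset of the derived graph. -/
lemma not_isCutset (h : IsBuildTime k G B t) {R : Set V} (hR : R.ncard = k)
    (hclq : G.IsClique {v | v ∉ R ∧ ¬ IsSimplicial G v ∧ (v ∈ B ∨ earlierNbrs G t v = R)}) :
    ¬ IsCutset (derivedGraph G) (Subtype.val ⁻¹' R) := by
  rintro ⟨-, hcut⟩
  apply hcut
  set H := (derivedGraph G).induce (Subtype.val ⁻¹' R)ᶜ
  have key : ∀ m, ∀ x : ((Subtype.val ⁻¹' R)ᶜ : Set {v | ¬ IsSimplicial G v}), t x.1.1 = m →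
      ∃ y : ((Subtype.val ⁻¹' R)ᶜ : Set {v | ¬ IsSimplicial G v}),
        (y.1.1 ∈ B ∨ earlierNbrs G t y.1.1 = R) ∧ H.Reachable x y := by
    intro m
    induction m using Nat.strong_induction_on with
    | _ m ih =>
      rintro ⟨⟨x, hx⟩, hxR⟩ rfl
      by_cases hxA : x ∈ B ∨ earlierNbrs G t x = R
      · exact ⟨_, hxA, .rfl⟩
      push Not at hxA
      obtain ⟨y, hy, hyR⟩ : ∃ y ∈ earlierNbrs G t x, y ∉ R := by
        by_contra! hcon
        exact hxA.2 (Set.eq_of_subset_of_ncard_le hcon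
          (by rw [hR, h.ncard x hxA.1]) (Set.toFinite _))
      have hys := h.not_isSimplicial_of_mem hy
      obtain ⟨z, hz, hyz⟩ := ih (t y) hy.2 ⟨⟨y, hys⟩, hyR⟩ rfl
      refine ⟨z, hz, Reachable.trans (Adj.reachable ?_) hyz⟩
      exact hy.1
  intro x y
  obtain ⟨x', hx', hxx⟩ := key _ x rfl
  obtain ⟨y', hy', hyy⟩ := key _ y rfl
  refine hxx.trans (Reachable.trans ?_ hyy.symm)
  by_cases heq : x' = y'
  · rw [heq]
  · exact Adj.reachable (hclq ⟨x'.2, x'.1.2, hx'⟩ ⟨y'.2, y'.1.2, hy'⟩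
      fun hh => heq (Subtype.ext (Subtype.ext hh)))

/-- If every vertex attached to the base is simplicial, then all vertices are attached to it. -/
lemma earlierNbrs_eq_base (h : IsBuildTime k G B t)
    (hB : ∀ v, v ∉ B → earlierNbrs G t v = B → IsSimplicial G v) :
    ∀ v, v ∉ B → earlierNbrs G t v = B := by
  have key : ∀ m v, t v = m → v ∉ B → earlierNbrs G t v = B := by
    intro m
    induction m using Nat.strong_induction_on with
    | _ m ih =>
      rintro v rfl hv
      refine Set.eq_of_subset_of_ncard_le (fun y hy => ?_)
        (by rw [h.ncard_base, h.ncard v hv]) (Set.toFinite _)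
      by_contra hyB
      exact h.not_isSimplicial_of_mem hy (hB y hyB (ih _ hy.2 y rfl hyB))
  exact fun v => key _ v rfl

end IsBuildTime

end BuildTime


section HostTree

variable {V : Type*} {k : ℕ} {G : SimpleGraph V} {B : Set V} {t : V → ℕ}

/-- A ranking of the vertices in which simplicial vertices come first, except that the lowest of
the vertices attached to the base is non-simplicial if there is another such vertex. -/
structure IsRanking (G : SimpleGraph V) (B : Set V) (t : V → ℕ) (r : V) (ρ : V → ℕ) : Prop where
  injective : Function.Injective ρ
  root_not_mem : r ∉ B
  earlierNbrs_root : earlierNbrs G t r = B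
  root_le : ∀ w, w ∉ B → earlierNbrs G t w = B → ρ r ≤ ρ w
  lt : ∀ u v, IsSimplicial G u → ¬ IsSimplicial G v → v ≠ r → ρ u < ρ v
  exists_ne : ¬ IsSimplicial G r →
    ∃ v, v ≠ r ∧ v ∉ B ∧ earlierNbrs G t v = B ∧ ¬ IsSimplicial G v
  eq_of_isSimplicial : IsSimplicial G r → ∀ u v, u ∉ B → v ∉ B → earlierNbrs G t u = B →
    earlierNbrs G t v = B → ¬ IsSimplicial G u → ¬ IsSimplicial G v → u = v

/-- `w` is the parent of `v` in the host tree: its predecessor among the vertices attached to the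
same clique, or the last vertex of that clique if there is no predecessor. -/
def IsParent (G : SimpleGraph V) (B : Set V) (t ρ : V → ℕ) (v w : V) : Prop :=
  w ∉ B ∧ ((earlierNbrs G t w = earlierNbrs G t v ∧ ρ w < ρ v ∧
      ∀ x, x ∉ B → earlierNbrs G t x = earlierNbrs G t v → ρ x < ρ v → ρ x ≤ ρ w) ∨
    ((∀ x, x ∉ B → earlierNbrs G t x = earlierNbrs G t v → ρ v ≤ ρ x) ∧
      w ∈ earlierNbrs G t v ∧ ∀ x ∈ earlierNbrs G t v, t x ≤ t w))

lemma IsBuildTime.mem_of_isParent (h : IsBuildTime k G B t) {ρ : V → ℕ} {v w x : V} (hv : v ∉ B)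
    (hw : IsParent G B t ρ v w) (hx : x ∈ earlierNbrs G t v) :
    x = w ∨ x ∈ earlierNbrs G t w := by
  obtain ⟨hwB, ⟨hew, -⟩ | ⟨-, hwv, hmax⟩⟩ := hw
  · exact .inr (hew ▸ hx)
  · by_cases hxw : x = w
    · exact .inl hxw
    · have hadj : G.Adj w x := h.isClique v hv hwv hx (Ne.symm hxw)
      exact .inr ⟨hadj, lt_of_le_of_ne (hmax x hx) (h.ne_of_adj x w hadj.symm hwB)⟩

variable [Finite V]

lemma IsBuildTime.exists_isRanking (h : IsBuildTime k G B t) : ∃ r ρ, IsRanking G B t r ρ := by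
  classical
  obtain ⟨n, ⟨e⟩⟩ := Finite.exists_equiv_fin V
  set σ : V → ℕ := fun v => if IsSimplicial G v then (e v : ℕ) else n + e v with hσ
  have hσs : ∀ v, IsSimplicial G v → σ v = e v := fun v hv => if_pos hv
  have hσn : ∀ v, ¬ IsSimplicial G v → σ v = n + e v := fun v hv => if_neg hv
  have hinj : Function.Injective σ := by
    intro u v huv
    apply e.injective
    apply Fin.ext
    by_cases hu : IsSimplicial G u <;> by_cases hv : IsSimplicial G v <;>
      simp only [hσ, hu, hv, if_true, if_false] at huv <;> omega
  have hlt : ∀ u v, IsSimplicial G u → ¬ IsSimplicial G v → σ u < σ v := by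
    intro u v hu hv
    rw [hσs u hu, hσn v hv]
    omega
  by_cases hc : ∃ c d, c ≠ d ∧ c ∉ B ∧ d ∉ B ∧ earlierNbrs G t c = B ∧ earlierNbrs G t d = B ∧
      ¬ IsSimplicial G c ∧ ¬ IsSimplicial G d
  · obtain ⟨c, d, hcd, hcB, hdB, hec, hed, hcs, hds⟩ := hc
    refine ⟨c, fun v => if v = c then 0 else σ v + 1, ?_, hcB, hec, ?_, ?_,
      fun _ => ⟨d, hcd.symm, hdB, hed, hds⟩, fun hs => absurd hs hcs⟩
    · intro u v huv
      by_cases hu : u = c <;> by_cases hv : v = c <;> simp [hu, hv] at huv ⊢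
      exact hinj huv
    · intro w _ _
      simp
    · intro u v hu hv hvc
      have huc : u ≠ c := fun huc => hcs (huc ▸ hu)
      simpa [huc, hvc] using hlt u v hu hv
  · push Not at hc
    obtain ⟨a, b, hab, haB, hbB, hea, heb⟩ := h.exists_pair
    obtain ⟨r, ⟨hrB, her⟩, hmin⟩ := ({v | v ∉ B ∧ earlierNbrs G t v = B}).toFinite.exists_minimalFor
      σ _ ⟨a, haB, hea⟩
    have hmin' : ∀ w, w ∉ B → earlierNbrs G t w = B → σ r ≤ σ w := by
      intro w hw hew
      by_contra hlt
      exact hlt (hmin ⟨hw, hew⟩ (not_le.1 hlt).le)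
    have hrs : IsSimplicial G r := by
      by_contra hrs
      have hx : ∀ x, x ∉ B → earlierNbrs G t x = B → ¬ IsSimplicial G x := by
        intro x hxB hex hx
        exact absurd (hlt x r hx hrs) (not_lt.2 (hmin' x hxB hex))
      exact hx b hbB heb (hc a b hab haB hbB hea heb (hx a haB hea))
    refine ⟨r, σ, hinj, hrB, her, hmin', fun u v hu hv _ => hlt u v hu hv,
      fun hn => absurd hrs hn, fun _ u v hu hv heu hev hus hvs => ?_⟩
    by_contra huv
    exact hvs (hc u v huv hu hv heu hev hus)

/-- A non-simplicial vertex is the parent of a vertex that is not attached to the base. -/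
lemma IsBuildTime.exists_isParent_of_not_isSimplicial (h : IsBuildTime k G B t) (ρ : V → ℕ)
    {v : V} (hv : v ∉ B) (hs : ¬ IsSimplicial G v) :
    ∃ w, w ∉ B ∧ earlierNbrs G t w ≠ B ∧ ∀ u, IsParent G B t ρ w u → u = v := by
  obtain ⟨x, hx, hmin⟩ := ({x | v ∈ earlierNbrs G t x}).toFinite.exists_minimalFor t _
    (h.exists_mem_of_not_isSimplicial hv hs)
  have hmax : ∀ y ∈ earlierNbrs G t x, y ≠ v → t y < t v := by
    intro y hy hyv
    have hadj : G.Adj y v := h.isClique x (h.not_mem_of_mem_earlierNbrs hx) hy hx hyv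
    rcases h.mem_or_mem_of_adj hv hadj with h' | h'
    · exact h'.2
    · exact absurd (hmin h' hy.2.le) (not_le.2 hy.2)
  obtain ⟨w, ⟨hwB, hew⟩, hfirst⟩ :=
    ({w | w ∉ B ∧ earlierNbrs G t w = earlierNbrs G t x}).toFinite.exists_minimalFor ρ _
      ⟨x, h.not_mem_of_mem_earlierNbrs hx, rfl⟩
  refine ⟨w, hwB, fun hB => hv ?_, ?_⟩
  · rw [← hB, hew]
    exact hx
  · rintro u ⟨huB, ⟨heu, hlt, -⟩ | ⟨-, hu, hmaxu⟩⟩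
    · exact absurd (hfirst ⟨huB, heu.trans hew⟩ hlt.le) (not_le.2 hlt)
    · rw [hew] at hu hmaxu
      by_contra huv
      exact absurd (hmaxu v hx) (not_le.2 (hmax u hu huv))

namespace IsRanking

variable {r : V} {ρ : V → ℕ}

lemma exists_isParent (hρ : IsRanking G B t r ρ) (h : IsBuildTime k G B t) {v : V} (hv : v ∉ B)
    (hvr : v ≠ r) : ∃ w, IsParent G B t ρ v w := by
  by_cases hsib : ∃ x, x ∉ B ∧ earlierNbrs G t x = earlierNbrs G t v ∧ ρ x < ρ v
  · obtain ⟨w, ⟨hwB, hew, hlt⟩, hmax⟩ :=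
      ({x | x ∉ B ∧ earlierNbrs G t x = earlierNbrs G t v ∧ ρ x < ρ v}).toFinite.exists_maximalFor
        ρ _ hsib
    refine ⟨w, hwB, .inl ⟨hew, hlt, fun x hx hex hxv => ?_⟩⟩
    by_contra hxw
    exact hxw (hmax ⟨hx, hex, hxv⟩ (not_le.1 hxw).le)
  · push Not at hsib
    have hne : earlierNbrs G t v ≠ B := by
      intro hev
      have h1 := hρ.root_le v hv hev
      have h2 := hsib r hρ.root_not_mem (hρ.earlierNbrs_root.trans hev.symm)
      exact hvr (hρ.injective (le_antisymm h2 h1))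
    obtain ⟨y, hy, hyB⟩ : ∃ y ∈ earlierNbrs G t v, y ∉ B := by
      by_contra! hcon
      exact hne (Set.eq_of_subset_of_ncard_le hcon
        (by rw [h.ncard_base, h.ncard v hv]) (Set.toFinite _))
    obtain ⟨w, hw, hmax⟩ := (earlierNbrs G t v).toFinite.exists_maximalFor t _ ⟨y, hy⟩
    have hmax' : ∀ x ∈ earlierNbrs G t v, t x ≤ t w := by
      intro x hx
      by_contra hxw
      exact hxw (hmax hx (not_le.1 hxw).le)
    refine ⟨w, fun hwB => ?_, .inr ⟨hsib, hw, hmax'⟩⟩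
    have := hmax' y hy
    rw [(h.eq_zero_iff w).2 hwB, Nat.le_zero, h.eq_zero_iff] at this
    exact hyB this

/-- A vertex that is not the highest of those attached to a clique is the parent of another
one. -/
lemma exists_isParent_of_lt (hρ : IsRanking G B t r ρ) {v x : V} (hv : v ∉ B) (hx : x ∉ B)
    (hex : earlierNbrs G t x = earlierNbrs G t v) (hlt : ρ v < ρ x) :
    ∃ w, w ∉ B ∧ earlierNbrs G t w = earlierNbrs G t v ∧ ρ v < ρ w ∧
      ∀ u, IsParent G B t ρ w u → u = v := by
  obtain ⟨w, ⟨hwB, hew, hvw⟩, hmin⟩ :=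
    ({w | w ∉ B ∧ earlierNbrs G t w = earlierNbrs G t v ∧ ρ v < ρ w}).toFinite.exists_minimalFor
      ρ _ ⟨x, hx, hex, hlt⟩
  refine ⟨w, hwB, hew, hvw, ?_⟩
  rintro u ⟨huB, ⟨heu, huw, hmax⟩ | ⟨hfirst, -⟩⟩
  · have h1 := hmax v hv hew.symm hvw
    rcases h1.lt_or_eq with h1 | h1
    · exact absurd (hmin ⟨huB, heu.trans hew, h1⟩ huw.le) (not_le.2 huw)
    · exact (hρ.injective h1).symm
  · exact absurd hvw (not_lt.2 (hfirst v hv hew.symm))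

end IsRanking

/-- The time of the last vertex of the clique to which `v` is attached, then the rank of `v`. -/
noncomputable def treeMeasure (G : SimpleGraph V) (t ρ : V → ℕ) (v : V) : ℕ ×ₗ ℕ :=
  toLex ((earlierNbrs G t v).toFinite.toFinset.sup t, ρ v)

lemma IsBuildTime.treeMeasure_lt (h : IsBuildTime k G B t) {ρ : V → ℕ} {v w : V}
    (hw : IsParent G B t ρ v w) : treeMeasure G t ρ w < treeMeasure G t ρ v := by
  rw [treeMeasure, treeMeasure, Prod.Lex.toLex_lt_toLex]
  obtain ⟨hwB, ⟨hew, hlt, -⟩ | ⟨-, hwv, hmax⟩⟩ := hw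
  · right
    simp only [hew]
    exact ⟨trivial, hlt⟩
  · left
    have hpos : 0 < t w := Nat.pos_of_ne_zero (mt (h.eq_zero_iff w).1 hwB)
    refine lt_of_lt_of_le ((Finset.sup_lt_iff hpos).2 fun x hx => ?_)
      (Finset.le_sup (f := t) (by simpa using hwv))
    rw [Set.Finite.mem_toFinset] at hx
    exact hx.2

/-- The simplicial neighborhoods that are not cutsets of the derived graph. -/
def nonCutNbhds (G : SimpleGraph V) : Set (Set V) :=
  {R | (∃ v, IsSimplicial G v ∧ G.neighborSet v = R) ∧
    ¬ IsCutset (derivedGraph G) (Subtype.val ⁻¹' R)}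

lemma IsBuildTime.exists_hostTree (h : IsBuildTime k G B t) :
    ∃ (T : SimpleGraph (Bᶜ : Set V)) (f : V → Set (Bᶜ : Set V)),
      T.IsTree ∧ IsSubtreeRep G T f ∧ numLeaves T ≤ max 2 (nonCutNbhds G).ncard := by
  classical
  obtain ⟨r, ρ, hρ⟩ := h.exists_isRanking
  have hex : ∀ v : (Bᶜ : Set V), ∃ w : (Bᶜ : Set V), v.1 ≠ r → IsParent G B t ρ v w := by
    intro v
    by_cases hvr : v.1 = r
    · exact ⟨v, fun hne => absurd hvr hne⟩
    · obtain ⟨w, hw⟩ := hρ.exists_isParent h v.2 hvr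
      exact ⟨⟨w, hw.1⟩, fun _ => hw⟩
  choose p hp using hex
  set r' : (Bᶜ : Set V) := ⟨r, hρ.root_not_mem⟩ with hr'
  have hne : ∀ v : (Bᶜ : Set V), v ≠ r' → v.1 ≠ r := fun v hv hh => hv (Subtype.ext hh)
  obtain ⟨μ, hμ⟩ : ∃ μ : (Bᶜ : Set V) → ℕ ×ₗ ℕ, ∀ v, v ≠ r' → μ (p v) < μ v :=
    ⟨fun v => treeMeasure G t ρ v, fun v hv => h.treeMeasure_lt (hp v (hne v hv))⟩
  set T := parentGraph p r' with hT
  set f : V → Set (Bᶜ : Set V) := fun x => {n | x = n.1 ∨ x ∈ earlierNbrs G t n} with hf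
  refine ⟨T, f, parentGraph_isTree hμ, ⟨fun x => ?_, fun u v huv => ⟨fun hadj => ?_, ?_⟩⟩, ?_⟩
  · by_cases hx : x ∈ B
    · refine induce_parentGraph_connected hμ (s := r') (.inr (hρ.earlierNbrs_root ▸ hx)) ?_
      rintro v (hv | hv) hvr
      · exact absurd (hv ▸ hx) v.2
      · exact ⟨hvr, h.mem_of_isParent v.2 (hp v (hne v hvr)) hv⟩
    · refine induce_parentGraph_connected hμ (s := ⟨x, hx⟩) (.inl rfl) ?_
      rintro v (hv | hv) hvx
      · exact absurd (Subtype.ext hv.symm) hvx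
      · have hvr : v ≠ r' := by
          rintro rfl
          exact hx (hρ.earlierNbrs_root ▸ hv)
        exact ⟨hvr, h.mem_of_isParent v.2 (hp v (hne v hvr)) hv⟩
  · by_cases hv : v ∈ B
    · by_cases hu : u ∈ B
      · exact ⟨r', .inr (hρ.earlierNbrs_root ▸ hu), .inr (hρ.earlierNbrs_root ▸ hv)⟩
      · refine ⟨⟨u, hu⟩, .inl rfl, .inr ⟨hadj, ?_⟩⟩
        rw [(h.eq_zero_iff v).2 hv]
        exact Nat.pos_of_ne_zero (mt (h.eq_zero_iff u).1 hu)
    · rcases h.mem_or_mem_of_adj hv hadj with h' | h'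
      · exact ⟨⟨v, hv⟩, .inr h', .inl rfl⟩
      · exact ⟨⟨u, h.not_mem_of_mem_earlierNbrs h'⟩, .inl rfl, .inr h'⟩
  · rintro ⟨n, hu | hu, hv | hv⟩
    · exact absurd (hu.trans hv.symm) huv
    · exact hu ▸ hv.1
    · exact hv ▸ hu.1.symm
    · exact h.isClique n n.2 hu hv huv
  have hchild : ∀ a : (Bᶜ : Set V), IsLeaf T a → a ≠ r' → ∀ w, (hw : w ∉ B) → w ≠ r →
      ¬ ∀ u, IsParent G B t ρ w u → u = a := by
    intro a ha har w hw hwr hu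
    refine parent_ne_of_isLeaf hμ ha har (v := ⟨w, hw⟩) (fun hh => hwr (congrArg Subtype.val hh)) ?_
    exact Subtype.ext (hu _ (hp ⟨w, hw⟩ hwr))
  have hsimp : ∀ a : (Bᶜ : Set V), IsLeaf T a → a ≠ r' → IsSimplicial G a := by
    intro a ha har
    by_contra hs
    obtain ⟨w, hw, hew, hu⟩ := h.exists_isParent_of_not_isSimplicial ρ a.2 hs
    exact hchild a ha har w hw (by rintro rfl; exact hew hρ.earlierNbrs_root) hu
  have hlast : ∀ a : (Bᶜ : Set V), IsLeaf T a → a ≠ r' → ∀ x, x ∉ B →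
      earlierNbrs G t x = earlierNbrs G t a → ρ x ≤ ρ a := by
    intro a ha har x hx hex
    by_contra hlt
    obtain ⟨w, hw, hew, haw, hu⟩ := hρ.exists_isParent_of_lt a.2 hx hex (not_le.1 hlt)
    refine hchild a ha har w hw ?_ hu
    rintro rfl
    exact absurd (hρ.root_le a a.2 (hew.symm.trans hρ.earlierNbrs_root)) (not_le.2 haw)
  by_cases hstar : ∀ v, v ∉ B → earlierNbrs G t v = B → IsSimplicial G v
  · refine le_max_of_le_left ?_
    have hall := h.earlierNbrs_eq_base hstar
    have hsub : ∃ m, {a | IsLeaf T a} ⊆ {r', m} := by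
      by_cases hm : ∃ m, IsLeaf T m ∧ m ≠ r'
      · obtain ⟨m, hm, hmr⟩ := hm
        refine ⟨m, fun a ha => ?_⟩
        by_cases har : a = r'
        · exact .inl har
        · refine .inr (Subtype.ext (hρ.injective (le_antisymm ?_ ?_)))
          · exact hlast m hm hmr a a.2 ((hall a a.2).trans (hall m m.2).symm)
          · exact hlast a ha har m m.2 ((hall m m.2).trans (hall a a.2).symm)
      · push Not at hm
        exact ⟨r', fun a ha => .inl (hm a ha)⟩
    obtain ⟨m, hm⟩ := hsub
    exact (Set.ncard_le_ncard hm (Set.toFinite _)).trans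
      ((Set.ncard_insert_le _ _).trans (by rw [Set.ncard_singleton]))
  · refine le_max_of_le_right ?_
    have hneB : ∀ a : (Bᶜ : Set V), IsLeaf T a → a ≠ r' → earlierNbrs G t a ≠ B := by
      intro a ha har hea
      apply hstar
      intro v hv hev
      by_contra hvs
      have hx : ∃ x, x ≠ r ∧ x ∉ B ∧ earlierNbrs G t x = B ∧ ¬ IsSimplicial G x := by
        by_cases hvr : v = r
        · exact hρ.exists_ne (hvr ▸ hvs)
        · exact ⟨v, hvr, hv, hev, hvs⟩
      obtain ⟨x, hxr, hxB, hex, hxs⟩ := hx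
      exact absurd (hlast a ha har x hxB (hex.trans hea.symm))
        (not_le.2 (hρ.lt a x (hsimp a ha har) hxs hxr))
    have hmaps : ∀ a ∈ {a | IsLeaf T a}, earlierNbrs G t a.1 ∈ nonCutNbhds G := by
      intro a ha
      by_cases har : a = r'
      · subst har
        have hrs : IsSimplicial G r := by
          by_contra hrs
          obtain ⟨v, hvr, hv, hev, -⟩ := hρ.exists_ne hrs
          have hlt : ρ r < ρ v := lt_of_le_of_ne (hρ.root_le v hv hev)
            (fun hh => hvr (hρ.injective hh).symm)
          obtain ⟨w, hw, hew, hrw, hu⟩ := hρ.exists_isParent_of_lt hρ.root_not_mem hv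
            (hev.trans hρ.earlierNbrs_root.symm) hlt
          obtain ⟨w', hw', hew', hu'⟩ :=
            h.exists_isParent_of_not_isSimplicial ρ hρ.root_not_mem hrs
          have hwr : w ≠ r := by rintro rfl; exact lt_irrefl _ hrw
          have hwr' : w' ≠ r := by rintro rfl; exact hew' hρ.earlierNbrs_root
          have h1 : T.Adj r' ⟨w, hw⟩ := by
            have := parentGraph_adj hμ (v := ⟨w, hw⟩)
              (fun hh => hwr (congrArg Subtype.val hh))
            rw [show p ⟨w, hw⟩ = r' from Subtype.ext (hu _ (hp ⟨w, hw⟩ hwr))] at this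
            exact this.symm
          have h2 : T.Adj r' ⟨w', hw'⟩ := by
            have := parentGraph_adj hμ (v := ⟨w', hw'⟩)
              (fun hh => hwr' (congrArg Subtype.val hh))
            rw [show p ⟨w', hw'⟩ = r' from Subtype.ext (hu' _ (hp ⟨w', hw'⟩ hwr'))] at this
            exact this.symm
          refine not_isLeaf_of_adj_of_adj h1 h2 (fun hh => hew' ?_) ha
          have hww : w = w' := congrArg Subtype.val hh
          rw [← hww, hew, hρ.earlierNbrs_root]
        refine ⟨⟨r, hrs, h.neighborSet_eq hrs⟩, ?_⟩
        change ¬ IsCutset (derivedGraph G) (Subtype.val ⁻¹' earlierNbrs G t r)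
        rw [hρ.earlierNbrs_root]
        refine h.not_isCutset h.ncard_base ?_
        rintro u ⟨huB, hus, hu⟩ v ⟨hvB, hvs, hv⟩ huv
        exact absurd (hρ.eq_of_isSimplicial hrs u v huB hvB (hu.resolve_left huB)
          (hv.resolve_left hvB) hus hvs) huv
      · have has := hsimp a ha har
        refine ⟨⟨a, has, h.neighborSet_eq has⟩, h.not_isCutset (h.ncard a a.2) ?_⟩
        have hB : ∀ u, ¬ IsSimplicial G u → u ∈ B ∨ earlierNbrs G t u = earlierNbrs G t a →
            u ∈ B := by
          rintro u hus (hu | hu)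
          · exact hu
          · by_contra huB
            refine absurd (hlast a ha har u huB hu) (not_le.2 (hρ.lt a u has hus ?_))
            rintro rfl
            exact hneB a ha har (hu.symm.trans hρ.earlierNbrs_root)
        rintro u ⟨-, hus, hu⟩ v ⟨-, hvs, hv⟩ huv
        exact h.isClique_base (hB u hus hu) (hB v hvs hv) huv
    refine Set.ncard_le_ncard_of_injOn (fun a : (Bᶜ : Set V) => earlierNbrs G t a) hmaps ?_
      (Set.toFinite _)
    intro a ha b hb hab
    by_cases har : a = r' <;> by_cases hbr : b = r'
    · rw [har, hbr]
    · subst har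
      exact absurd (hab.symm.trans hρ.earlierNbrs_root) (hneB b hb hbr)
    · subst hbr
      exact absurd (hab.trans hρ.earlierNbrs_root) (hneB a ha har)
    · exact Subtype.ext (hρ.injective (le_antisymm (hlast b hb hbr a a.2 hab)
        (hlast a ha har b b.2 hab.symm)))

end HostTree


lemma IsSubtreeRep.disjoint {V W : Type*} {G : SimpleGraph V} {T : SimpleGraph W} {f : V → Set W}
    (hf : IsSubtreeRep G T f) {u v : V} (huv : u ≠ v) (hadj : ¬ G.Adj u v) :
    Disjoint (f u) (f v) := by
  rw [Set.disjoint_iff_inter_eq_empty, ← Set.not_nonempty_iff_eq_empty, ← hf.2 u v huv]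
  exact hadj

lemma IsSubtreeRep.exists_mem {V W : Type*} {G : SimpleGraph V} {T : SimpleGraph W}
    {f : V → Set W} (hf : IsSubtreeRep G T f) (v : V) : ∃ a, a ∈ f v := by
  obtain ⟨a⟩ := (hf.1 v).nonempty
  exact ⟨a, a.2⟩

/-- The subtrees of vertices connected in the derived graph outside the neighborhood of a
simplicial vertex `i` are connected outside the subtree of `i`. -/
lemma IsSubtreeRep.joinedOff_of_reachable {V W : Type*} {G : SimpleGraph V} {T : SimpleGraph W}
    {f : V → Set W} (hf : IsSubtreeRep G T f) {i : V} (hi : IsSimplicial G i)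
    {x y : ((Subtype.val ⁻¹' G.neighborSet i)ᶜ : Set {v | ¬ IsSimplicial G v})}
    (hxy : ((derivedGraph G).induce (Subtype.val ⁻¹' G.neighborSet i)ᶜ).Reachable x y) :
    ∀ a ∈ f x.1.1, ∀ b ∈ f y.1.1, JoinedOff T (f i) a b := by
  have hd : ∀ z : ((Subtype.val ⁻¹' G.neighborSet i)ᶜ : Set {v | ¬ IsSimplicial G v}),
      Disjoint (f z.1.1) (f i) := by
    intro z
    refine hf.disjoint (fun hz => z.1.2 (by rw [hz]; exact hi)) fun hadj => z.2 hadj.symm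
  obtain ⟨p⟩ := hxy
  induction p with
  | nil => exact fun a ha b hb => .of_isSubtree (hf.1 _) (hd _) ha hb
  | @cons u v w h q ih =>
    intro a ha b hb
    have hadj : G.Adj u.1.1 v.1.1 := h
    obtain ⟨c, hcu, hcv⟩ := (hf.2 _ _ hadj.ne).1 hadj
    exact (JoinedOff.of_isSubtree (hf.1 _) (hd _) ha hcu).trans (ih c hcv b hb)

lemma IsBuildTime.le_numLeaves {V W : Type*} [Finite V] [Finite W] {k : ℕ} {G : SimpleGraph V}
    {B : Set V} {t : V → ℕ} (h : IsBuildTime k G B t) {T : SimpleGraph W} {f : V → Set W}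
    (hT : T.IsTree) (hf : IsSubtreeRep G T f) : max 2 (nonCutNbhds G).ncard ≤ numLeaves T := by
  have hW : Nontrivial W := by
    obtain ⟨u, v, huv, hu, hv, heu, hev⟩ := h.exists_pair
    obtain ⟨a, ha⟩ := hf.exists_mem u
    obtain ⟨b, hb⟩ := hf.exists_mem v
    refine ⟨a, b, fun hab => ?_⟩
    have hadj : G.Adj u v := (hf.2 u v huv).2 ⟨a, ha, hab ▸ hb⟩
    rcases h.mem_or_mem_of_adj hv hadj with h' | h'
    · exact hu (hev ▸ h')
    · exact hv (heu ▸ h')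
  have h2 := two_le_numLeaves hT
  refine max_le h2 ?_
  rcases le_or_gt (nonCutNbhds G).ncard 1 with hle | hlt
  · omega
  have hι : Nontrivial (nonCutNbhds G) := by
    rw [← Nat.card_coe_set_eq] at hlt
    exact Finite.one_lt_card_iff_nontrivial.1 hlt
  have hR : ∀ R : nonCutNbhds G, ∃ v, IsSimplicial G v ∧ G.neighborSet v = R.1 := fun R => R.2.1
  choose v hv hvR using hR
  choose q hq using fun R => hf.exists_mem (v R)
  rw [← Nat.card_coe_set_eq]
  have hd : ∀ R S, R ≠ S → Disjoint (f (v R)) (f (v S)) := by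
    intro R S hRS
    refine hf.disjoint (fun hh => hRS (Subtype.ext ?_)) fun hadj =>
      h.not_isSimplicial_of_adj (hv R) hadj (hv S)
    rw [← hvR R, ← hvR S, hh]
  refine card_le_numLeaves_of_joinedOff hT (fun R => f (v R)) (fun R => hf.1 _) hd q hq ?_
  have hout : ∀ R S, S ≠ R →
      ∃ x : ((Subtype.val ⁻¹' G.neighborSet (v R))ᶜ : Set {v | ¬ IsSimplicial G v}),
        ∃ a ∈ f x.1.1, JoinedOff T (f (v R)) (q S) a := by
    intro R S hSR
    obtain ⟨x, hxS, hxR⟩ : ∃ x ∈ G.neighborSet (v S), x ∉ G.neighborSet (v R) := by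
      by_contra! hcon
      apply hSR
      apply Subtype.ext
      rw [← hvR R, ← hvR S]
      exact Set.eq_of_subset_of_ncard_le hcon
        (by rw [h.ncard_neighborSet (hv R), h.ncard_neighborSet (hv S)]) (Set.toFinite _)
    have hadj : G.Adj (v S) x := hxS
    obtain ⟨a, haS, hax⟩ := (hf.2 _ _ hadj.ne).1 hadj
    exact ⟨⟨⟨x, h.not_isSimplicial_of_adj (hv S) hadj⟩, hxR⟩, a, hax,
      .of_isSubtree (hf.1 _) (hd S R hSR) (hq S) haS⟩
  intro R S₁ S₂ h₁ h₂
  obtain ⟨x, a, hax, ha⟩ := hout R S₁ h₁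
  obtain ⟨y, b, hby, hb⟩ := hout R S₂ h₂
  have hncut := R.2.2
  rw [← hvR R] at hncut
  have hpre : ((derivedGraph G).induce (Subtype.val ⁻¹' G.neighborSet (v R))ᶜ).Preconnected := by
    by_contra hpre
    exact hncut ⟨⟨x.1, x.2⟩, hpre⟩
  exact (ha.trans (hf.joinedOff_of_reachable (hv R) (hpre x y) a hax b hby)).trans hb.symm

/-- Subtree representations can be transported to a host tree on an equivalent type. -/
lemma IsSubtreeRep.exists_fin {V W : Type*} [Finite W] {G : SimpleGraph V} {T : SimpleGraph W}
    {f : V → Set W} (hT : T.IsTree) (hf : IsSubtreeRep G T f) :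
    ∃ (m : ℕ) (T' : SimpleGraph (Fin m)) (f' : V → Set (Fin m)),
      T'.IsTree ∧ IsSubtreeRep G T' f' ∧ numLeaves T' = numLeaves T := by
  obtain ⟨m, ⟨e⟩⟩ := Finite.exists_equiv_fin W
  set φ := Iso.map e T
  refine ⟨m, T.map e.toEmbedding, fun v => e '' f v, φ.isTree_iff.1 hT, ⟨fun v => ?_, ?_⟩, ?_⟩
  · have hφ : (T.induce (f v)) ≃g ((T.map e.toEmbedding).induce (e '' f v)) :=
      φ.induce (e.injective.injOn.bijOn_image)
    exact hφ.connected_iff.1 (hf.1 v)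
  · intro u v huv
    rw [hf.2 u v huv, ← Set.image_inter e.injective, Set.image_nonempty]
  · have hnbr : ∀ a, (T.map e.toEmbedding).neighborSet (e a) = e '' T.neighborSet a := by
      intro a
      ext b
      obtain ⟨b, rfl⟩ := e.surjective b
      rw [e.injective.mem_set_image]
      exact φ.map_adj_iff
    have hset : {a | IsLeaf (T.map e.toEmbedding) a} = e '' {a | IsLeaf T a} := by
      ext a
      obtain ⟨a, rfl⟩ := e.surjective a
      rw [e.injective.mem_set_image]
      simp only [Set.mem_ofPred_eq, IsLeaf, hnbr, Set.ncard_image_of_injective _ e.injective]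
    rw [numLeaves, numLeaves, hset, Set.ncard_image_of_injective _ e.injective]

end Leafage

open SimpleGraph Leafage

theorem stmt5 {V : Type*} [Fintype V] (k : ℕ) (G : SimpleGraph V)
    (hk : IsKTree k G) (hnc : G ≠ ⊤) :
    leafage G = max 2
      ({R : Set V | (∃ v, IsSimplicial G v ∧ G.neighborSet v = R) ∧
        ¬ IsCutset (derivedGraph G) (Subtype.val ⁻¹' R)}.ncard) := by
  obtain ⟨B, t, h⟩ := hk.exists_isBuildTime hnc
  change leafage G = max 2 (nonCutNbhds G).ncard
  obtain ⟨T, f, hT, hf, hle⟩ := h.exists_hostTree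
  obtain ⟨m, T', f', hT', hf', heq⟩ := hf.exists_fin hT
  have hmem : numLeaves T' ∈ {L | ∃ (m : ℕ) (T : SimpleGraph (Fin m)) (f : V → Set (Fin m)),
      T.IsTree ∧ IsSubtreeRep G T f ∧ numLeaves T = L} := ⟨m, T', f', hT', hf', rfl⟩
  apply le_antisymm
  · exact (Nat.sInf_le hmem).trans (heq ▸ hle)
  · obtain ⟨m, T₀, f₀, hT₀, hf₀, heq₀⟩ := Nat.sInf_mem ⟨_, hmem⟩
    rw [leafage, ← heq₀]
    exact h.le_numLeaves hT₀ hf₀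
end

section
/- If P'(G) is the restricted simplicial neighborhood poset of a chordal graph G, then G has an asteroidal set consisting of w(P'(G)) simplicial vertices. -/
open SimpleGraph

namespace Leafage

/-- The neighbourhood of `v` with the simplicial vertices removed. -/
def modNbhd {V : Type*} (G : SimpleGraph V) (v : V) : Set V :=
  G.neighborSet v \ {w | IsSimplicial G w}

/-- The modified neighbourhood of a simplicial vertex is contained in that of any adjacent
simplicial vertex. -/
lemma modNbhd_subset_of_adj {V : Type*} {G : SimpleGraph V} {x z : V} (hx : IsSimplicial G x)
    (hz : IsSimplicial G z) (h : G.Adj z x) : modNbhd G x ⊆ modNbhd G z := by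
  rintro w ⟨hw, hws⟩
  refine ⟨hx h.symm hw ?_, hws⟩
  rintro rfl
  exact hws hz

/-- A finite family of sets has an antichain whose size is the width of the family. -/
lemma exists_antichain_ncard_eq_familyWidth {β : Type*} [Finite β] (F : Set (Set β)) :
    ∃ A, A ⊆ F ∧ (∀ x ∈ A, ∀ y ∈ A, x ≠ y → ¬ x ⊆ y) ∧ A.ncard = familyWidth F := by
  refine Nat.sSup_mem (s := {n | ∃ A, A ⊆ F ∧ (∀ x ∈ A, ∀ y ∈ A, x ≠ y → ¬ x ⊆ y) ∧
    A.ncard = n}) ⟨0, ∅, by simp⟩ ⟨Nat.card (Set β), ?_⟩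
  rintro n ⟨A, -, -, rfl⟩
  exact Set.ncard_le_card A

/-- If deleting the modified neighbourhood of a simplicial vertex `z` from the derived graph
leaves it connected, then any two simplicial vertices with modified neighbourhoods not
contained in that of `z` are joined by a walk avoiding the closed neighbourhood of `z`. -/
lemma asteroidalTriple_of_not_subset {V : Type*} {G : SimpleGraph V} {x y z : V}
    (hx : IsSimplicial G x) (hy : IsSimplicial G y) (hz : IsSimplicial G z)
    (hxz : ¬ modNbhd G x ⊆ modNbhd G z) (hyz : ¬ modNbhd G y ⊆ modNbhd G z)
    (hcut : ¬ IsCutset (derivedGraph G) (Subtype.val ⁻¹' modNbhd G z)) :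
    AsteroidalTriple G x y z := by
  have avoid {u : V} (hu : IsSimplicial G u) (huz : ¬ modNbhd G u ⊆ modNbhd G z) :
      u ≠ z ∧ ¬ G.Adj z u :=
    ⟨fun h => huz (h ▸ subset_rfl), fun h => huz (modNbhd_subset_of_adj hu hz h)⟩
  obtain ⟨x', ⟨hxx', hx's⟩, hx'z⟩ := Set.not_subset.mp hxz
  obtain ⟨y', ⟨hyy', hy's⟩, hy'z⟩ := Set.not_subset.mp hyz
  let S : Set {v | ¬ IsSimplicial G v} := (Subtype.val ⁻¹' modNbhd G z)ᶜ
  let a : S := ⟨⟨x', hx's⟩, hx'z⟩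
  let b : S := ⟨⟨y', hy's⟩, hy'z⟩
  have hconn : ((derivedGraph G).induce S).Preconnected := by
    by_contra h
    exact hcut ⟨⟨a.1, a.2⟩, h⟩
  obtain ⟨p⟩ := hconn a b
  rw [mem_neighborSet] at hxx' hyy'
  let f : (derivedGraph G).induce S →g G := ⟨fun v => v.1.1, fun h => h⟩
  refine ⟨.cons hxx' ((p.map f).concat hyy'.symm), fun w hw => ?_⟩
  rw [Walk.support_cons, Walk.support_concat, List.mem_cons,
    List.mem_append, List.mem_singleton, Walk.support_map, List.mem_map] at hw
  rcases hw with rfl | ⟨v, -, rfl⟩ | rfl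
  · exact avoid hx hxz
  · exact ⟨fun h : v.1.1 = z => v.1.2 (h.symm ▸ hz), fun h => v.2 ⟨h, v.1.2⟩⟩
  · exact avoid hy hyz

end Leafage

open SimpleGraph Leafage

theorem stmt10 {V : Type*} [Fintype V] (G : SimpleGraph V) (hG : IsChordal G) :
    ∃ A : Set V, AsteroidalSet G A ∧ (∀ v ∈ A, IsSimplicial G v) ∧
      A.ncard = familyWidth (restrictedModNbhds G) := by
  obtain ⟨F, hF, hanti, hcard⟩ := exists_antichain_ncard_eq_familyWidth (restrictedModNbhds G)
  have hrep (R : F) : ∃ v, IsSimplicial G v ∧ (R : Set V) = modNbhd G v := (hF R.2).1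
  choose f hsimp hf using hrep
  have hinj : Function.Injective f := fun R T h => Subtype.ext (by rw [hf R, hf T, h])
  refine ⟨Set.range f, ?_, ?_, ?_⟩
  · rintro _ ⟨R, rfl⟩ _ ⟨T, rfl⟩ _ ⟨U, rfl⟩ - hTU hRU
    have hns {K : F} (h : f K ≠ f U) : ¬ modNbhd G (f K) ⊆ modNbhd G (f U) := by
      rw [← hf, ← hf]
      exact hanti _ K.2 _ U.2 fun e => h (congrArg f (Subtype.ext e))
    exact asteroidalTriple_of_not_subset (hsimp R) (hsimp T) (hsimp U) (hns hRU) (hns hTU)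
      fun h => (hF U.2).2 ⟨_, (hf U).ge, h⟩
  · rintro _ ⟨R, rfl⟩
    exact hsimp R
  · rw [← hcard, ← Set.image_univ, Set.ncard_image_of_injective _ hinj, Set.ncard_univ]
    rfl
end
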